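/- arXiv:2409.03068 — 3 statements merged into one kernel-verified Lean document; each statement's English description precedes it below -/
import Mathlib

section
/- For every integer n ≥ 1: a_{1,1}(2n) + 4 = a_{1,2}(2n), and a_{2,1}(2n+1) + 4 = b_{2,2}(2n+1). -/
/-- The 16-letter alphabet 𝒜 = {A,…,P}. -/
inductive A16 : Type
  | A | B | C | D | E | F | G | H | I | J | K | L | M | N | O | P
  deriving DecidableEq

/-- The 2×2 block substitution μ on 𝒜 (rows top to bottom). -/
def mu : A16 → Fin 2 → Fin 2 → A16
  | .A => ![![.A, .F], ![.G, .C]]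
  | .B => ![![.A, .F], ![.H, .D]]
  | .C => ![![.B, .E], ![.G, .C]]
  | .D => ![![.B, .E], ![.H, .D]]
  | .E => ![![.A, .N], ![.G, .K]]
  | .F => ![![.A, .N], ![.H, .L]]
  | .G => ![![.B, .M], ![.G, .K]]
  | .H => ![![.B, .M], ![.H, .L]]
  | .I => ![![.I, .F], ![.O, .C]]
  | .J => ![![.I, .F], ![.P, .D]]
  | .K => ![![.J, .E], ![.O, .C]]
  | .L => ![![.J, .E], ![.P, .D]]
  | .M => ![![.I, .N], ![.O, .K]]
  | .N => ![![.I, .N], ![.P, .L]]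
  | .O => ![![.J, .M], ![.O, .K]]
  | .P => ![![.J, .M], ![.P, .L]]

/-- Entry version of μ, indexed by arbitrary naturals (via mod 2). -/
def muE (x : A16) (r c : ℕ) : A16 :=
  mu x ⟨r % 2, by omega⟩ ⟨c % 2, by omega⟩

/-- `superE n x` is the supertile μⁿ(x), a 2ⁿ×2ⁿ array over 𝒜,
given as a total function on ℕ × ℕ (only indices < 2ⁿ are relevant). -/
def superE : ℕ → A16 → ℕ → ℕ → A16
  | 0, x, _, _ => x
  | n + 1, x, r, c => muE (superE n x (r / 2) (c / 2)) r c

/-- The supertile T_k = μᵏ(N). -/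
def Tfun (k : ℕ) : ℕ → ℕ → A16 := superE k .N

/-- An m×n pattern over the alphabet α. -/
abbrev Pat (α : Type) (m n : ℕ) := Fin m → Fin n → α

/-- The set of m×n patterns occurring in the size×size array X. -/
def patIn {α : Type} (X : ℕ → ℕ → α) (size m n : ℕ) : Set (Pat α m n) :=
  { p | ∃ r c : ℕ, r + m ≤ size ∧ c + n ≤ size ∧
      ∀ (i : Fin m) (j : Fin n), p i j = X (r + i) (c + j) }

/-- P(T, m×n) = ⋃ₖ P(T_k, m×n). -/
def PT (m n : ℕ) : Set (Pat A16 m n) := ⋃ k : ℕ, patIn (Tfun k) (2 ^ k) m n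

/-- μ applied to an m×n pattern, as a total 2m×2n array on ℕ × ℕ
(indices are reduced mod the valid range; in range this is exactly μ(p)). -/
def muPatE {m n : ℕ} (p : Pat A16 m n) (r c : ℕ) : A16 :=
  if hm : 0 < m then
    if hn : 0 < n then
      muE (p ⟨r / 2 % m, Nat.mod_lt _ hm⟩ ⟨c / 2 % n, Nat.mod_lt _ hn⟩) r c
    else .A
  else .A

/-- μ² applied to an m×n pattern, as a total 4m×4n array on ℕ × ℕ. -/
def mu2PatE {m n : ℕ} (p : Pat A16 m n) (r c : ℕ) : A16 :=
  muE (muPatE p (r / 2) (c / 2)) r c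

/-- P_{i,j}(T, m×n) = { μ(x)[i,j,m×n] : x ∈ P(T,m×n) } (1-based corner (i,j)). -/
def Pij (i j m n : ℕ) : Set (Pat A16 m n) :=
  { q | ∃ x ∈ PT m n, ∀ (a : Fin m) (b : Fin n),
      q a b = muPatE x (i - 1 + a) (j - 1 + b) }

/-- Q_{i,j}(T, m×n) = { μ²(x)[i,j,m×n] : x ∈ P(T,m×n) } (1-based corner (i,j)). -/
def Qij (i j m n : ℕ) : Set (Pat A16 m n) :=
  { q | ∃ x ∈ PT m n, ∀ (a : Fin m) (b : Fin n),
      q a b = mu2PatE x (i - 1 + a) (j - 1 + b) }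

/-- The 2×2 block substitution φ from 𝒜 to ℬ = {0,1,2,3}. -/
def phi : A16 → Fin 2 → Fin 2 → Fin 4
  | .A => ![![0, 1], ![0, 0]]
  | .B => ![![0, 1], ![1, 1]]
  | .C => ![![1, 0], ![0, 0]]
  | .D => ![![1, 0], ![1, 1]]
  | .E => ![![0, 3], ![0, 2]]
  | .F => ![![0, 3], ![1, 3]]
  | .G => ![![1, 2], ![0, 2]]
  | .H => ![![1, 2], ![1, 3]]
  | .I => ![![2, 1], ![2, 0]]
  | .J => ![![2, 1], ![3, 1]]
  | .K => ![![3, 0], ![2, 0]]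
  | .L => ![![3, 0], ![3, 1]]
  | .M => ![![2, 3], ![2, 2]]
  | .N => ![![2, 3], ![3, 3]]
  | .O => ![![3, 2], ![2, 2]]
  | .P => ![![3, 2], ![3, 3]]

/-- Entry version of φ, indexed by arbitrary naturals (via mod 2). -/
def phiE (x : A16) (r c : ℕ) : Fin 4 :=
  phi x ⟨r % 2, by omega⟩ ⟨c % 2, by omega⟩

/-- φ applied to an m×n pattern over 𝒜, as a total 2m×2n array on ℕ × ℕ. -/
def phiPatE {m n : ℕ} (p : Pat A16 m n) (r c : ℕ) : Fin 4 :=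
  if hm : 0 < m then
    if hn : 0 < n then
      phiE (p ⟨r / 2 % m, Nat.mod_lt _ hm⟩ ⟨c / 2 % n, Nat.mod_lt _ hn⟩) r c
    else 0
  else 0

/-- φ(T_k), a 2^(k+1)×2^(k+1) array over ℬ. -/
def Sfun (k : ℕ) (r c : ℕ) : Fin 4 := phiE (Tfun k (r / 2) (c / 2)) r c

/-- P(S, m×n) = ⋃_{k≥1} P(φ(T_{k-1}), m×n). -/
def PS (m n : ℕ) : Set (Pat (Fin 4) m n) :=
  ⋃ k : ℕ, patIn (Sfun k) (2 ^ (k + 1)) m n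

/-- P_{i,j}(S, m×n) = { φ(x)[i,j,m×n] : x ∈ P(T,m×n) } (1-based corner (i,j)). -/
def PSij (i j m n : ℕ) : Set (Pat (Fin 4) m n) :=
  { q | ∃ x ∈ PT m n, ∀ (a : Fin m) (b : Fin n),
      q a b = phiPatE x (i - 1 + a) (j - 1 + b) }

/-- A_n = |P(S, n×n)|. -/
noncomputable def Acnt (n : ℕ) : ℕ := Nat.card (PS n n)

/-- a_{i,j}(n) = |P_{i,j}(T, n×n)|. -/
noncomputable def aT (i j n : ℕ) : ℕ := Nat.card (Pij i j n n)

/-- b_{i,j}(n) = |P_{i,j}(T, n×(n+1))|. -/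
noncomputable def bT (i j n : ℕ) : ℕ := Nat.card (Pij i j n (n + 1))

/-- c_{i,j}(n) = |P_{i,j}(T, (n+1)×n)|. -/
noncomputable def cT (i j n : ℕ) : ℕ := Nat.card (Pij i j (n + 1) n)

namespace PlusFour

/-- The left edge label of a letter. -/
def left : A16 → Bool
  | .I | .J | .K | .L | .M | .N | .O | .P => true
  | _ => false

/-- The right edge label of a letter. -/
def right : A16 → Bool
  | .E | .F | .G | .H | .M | .N | .O | .P => true
  | _ => false

/-- The top edge label of a letter. -/
def top : A16 → Bool
  | .C | .D | .G | .H | .K | .L | .O | .P => true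
  | _ => false

/-- The bottom edge label of a letter. -/
def bot : A16 → Bool
  | .B | .D | .F | .H | .J | .L | .N | .P => true
  | _ => false

theorem letter_ext {x y : A16} (hl : left x = left y) (hr : right x = right y)
    (ht : top x = top y) (hb : bot x = bot y) : x = y := by
  cases x <;> cases y <;> first | rfl | simp [left, right, top, bot] at hl hr ht hb

instance : Finite A16 :=
  Finite.of_injective (fun x => (left x, right x, top x, bot x)) fun x y h => by
    simp only [Prod.mk.injEq] at h
    exact letter_ext h.1 h.2.1 h.2.2.1 h.2.2.2

theorem muE_congr_mod (x : A16) {r r' c c' : ℕ} (hr : r % 2 = r' % 2) (hc : c % 2 = c' % 2) :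
    muE x r c = muE x r' c' := by
  simp only [muE, hr, hc]

theorem muE_cases (P : A16 → ℕ → ℕ → A16 → Prop) (x : A16) (r c : ℕ)
    (h : ∀ i < 2, ∀ j < 2, P x i j (muE x i j)) : P x (r % 2) (c % 2) (muE x r c) := by
  rw [muE_congr_mod x (Nat.mod_mod r 2).symm (Nat.mod_mod c 2).symm]
  exact h _ (Nat.mod_lt _ two_pos) _ (Nat.mod_lt _ two_pos)

theorem left_muE (x : A16) (r c : ℕ) :
    left (muE x r c) = if c % 2 = 0 then left x else right x := by
  refine muE_cases (fun x _ j y => left y = if j = 0 then left x else right x) x r c ?_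
  intro i hi j hj
  interval_cases i <;> interval_cases j <;> cases x <;> rfl

theorem right_muE (x : A16) (r c : ℕ) :
    right (muE x r c) = decide (r % 2 ≠ c % 2) := by
  refine muE_cases (fun _ i j y => right y = decide (i ≠ j)) x r c ?_
  intro i hi j hj
  interval_cases i <;> interval_cases j <;> cases x <;> rfl

theorem top_muE (x : A16) (r c : ℕ) : top (muE x r c) = decide (r % 2 = 1) := by
  refine muE_cases (fun _ i _ y => top y = decide (i = 1)) x r c ?_
  intro i hi j hj
  interval_cases i <;> interval_cases j <;> cases x <;> rfl

theorem bot_muE (x : A16) (r c : ℕ) :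
    bot (muE x r c) = if r % 2 = 1 then bot x else if c % 2 = 0 then top x else !top x := by
  refine muE_cases (fun x i j y => bot y = if i = 1 then bot x else
    if j = 0 then top x else !top x) x r c ?_
  intro i hi j hj
  interval_cases i <;> interval_cases j <;> cases x <;> rfl

theorem muE_congr_of_odd {x y : A16} {r c : ℕ} (hc : c % 2 = 1) (hr : right x = right y)
    (ht : top x = top y) (hb : bot x = bot y) : muE x r c = muE y r c := by
  apply letter_ext <;> simp [left_muE, right_muE, top_muE, bot_muE, hc, hr, ht, hb]

theorem Tfun_succ (k r c : ℕ) : Tfun (k + 1) r c = muE (Tfun k (r / 2) (c / 2)) r c := rfl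

theorem top_Tfun {k : ℕ} (hk : k ≠ 0) (r c : ℕ) : top (Tfun k r c) = decide (r % 2 = 1) := by
  obtain ⟨k, rfl⟩ := Nat.exists_eq_succ_of_ne_zero hk
  exact top_muE _ _ _

theorem right_Tfun {k : ℕ} (hk : k ≠ 0) (r c : ℕ) :
    right (Tfun k r c) = decide (r % 2 ≠ c % 2) := by
  obtain ⟨k, rfl⟩ := Nat.exists_eq_succ_of_ne_zero hk
  exact right_muE _ _ _

theorem top_Tfun_eq (k r c c' : ℕ) : top (Tfun k r c) = top (Tfun k r c') := by
  cases k with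
  | zero => rfl
  | succ k => rw [Tfun_succ, Tfun_succ, top_muE, top_muE]

theorem right_Tfun_succ_row {k : ℕ} (hk : k ≠ 0) (r c : ℕ) :
    right (Tfun k (r + 1) c) = !right (Tfun k r c) := by
  rw [right_Tfun hk, right_Tfun hk, ← decide_not, decide_eq_decide]
  omega

theorem bot_Tfun_succ_col_of_even {k r : ℕ} (hk : k ≠ 0) (hr : r % 2 = 0) (c : ℕ) :
    bot (Tfun k r (c + 1)) = !bot (Tfun k r c) := by
  obtain ⟨k, rfl⟩ := Nat.exists_eq_succ_of_ne_zero hk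
  rw [Nat.succ_eq_add_one, Tfun_succ, Tfun_succ, bot_muE, bot_muE,
    top_Tfun_eq k (r / 2) ((c + 1) / 2) (c / 2)]
  rcases Nat.mod_two_eq_zero_or_one c with h | h
  · simp [hr, h, show (c + 1) % 2 = 1 by omega]
  · simp [hr, h, show (c + 1) % 2 = 0 by omega]

theorem bot_Tfun_succ_col_of_odd {k r c : ℕ} (hk : k ≠ 0) (hr : r % 2 = 1) (hc : c % 2 = 0) :
    bot (Tfun k r (c + 1)) = bot (Tfun k r c) := by
  obtain ⟨k, rfl⟩ := Nat.exists_eq_succ_of_ne_zero hk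
  rw [Nat.succ_eq_add_one, Tfun_succ, Tfun_succ, bot_muE, bot_muE,
    show (c + 1) / 2 = c / 2 by omega]
  simp [hr]

/-- At every interior vertex exactly one of the two lines through it changes its label. -/
theorem crossing (k r c : ℕ) (hr : r + 1 < 2 ^ k) :
    (bot (Tfun k r c) ^^ bot (Tfun k r (c + 1))) =
      !(left (Tfun k r (c + 1)) ^^ left (Tfun k (r + 1) (c + 1))) := by
  induction k generalizing r c with
  | zero => simp at hr
  | succ k ih =>
    rcases Nat.mod_two_eq_zero_or_one r with h | h
    · rw [bot_Tfun_succ_col_of_even k.succ_ne_zero h]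
      simp only [Tfun_succ, left_muE, show (r + 1) / 2 = r / 2 by omega]
      simp
    · rcases Nat.mod_two_eq_zero_or_one c with hc | hc
      · have hk : k ≠ 0 := by rintro rfl; omega
        rw [bot_Tfun_succ_col_of_odd k.succ_ne_zero h hc]
        simp only [Tfun_succ, left_muE, show (r + 1) / 2 = r / 2 + 1 by omega,
          right_Tfun_succ_row hk, show (c + 1) % 2 = 1 by omega]
        simp
      · have := ih (r / 2) (c / 2) (by rw [pow_succ] at hr; omega)
        simp only [Tfun_succ, left_muE, bot_muE, h, show (r + 1) / 2 = r / 2 + 1 by omega,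
          show (c + 1) / 2 = c / 2 + 1 by omega, show (c + 1) % 2 = 0 by omega]
        simpa using this

theorem superE_add (a b : ℕ) (x : A16) (r c : ℕ) :
    superE (a + b) x r c = superE a (superE b x (r / 2 ^ a) (c / 2 ^ a)) r c := by
  induction a generalizing r c with
  | zero => simp [superE]
  | succ a ih =>
    rw [Nat.add_right_comm]
    simp only [superE, ih, Nat.div_div_eq_div_mul, pow_succ']

theorem superE_add_mul (a : ℕ) (x : A16) (r c r₀ c₀ : ℕ) :
    superE a x (r₀ * 2 ^ a + r) (c₀ * 2 ^ a + c) = superE a x r c := by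
  induction a generalizing r c with
  | zero => rfl
  | succ a ih =>
    have h (m n : ℕ) : (m * 2 ^ (a + 1) + n) / 2 = m * 2 ^ a + n / 2 := by
      rw [pow_succ, ← mul_assoc]; omega
    simp only [superE, h, ih]
    apply muE_congr_mod <;> rw [pow_succ, ← mul_assoc] <;> omega

theorem Tfun_add {a r c : ℕ} (b r₀ c₀ : ℕ) (hr : r < 2 ^ a) (hc : c < 2 ^ a) :
    Tfun (a + b) (r₀ * 2 ^ a + r) (c₀ * 2 ^ a + c) = superE a (Tfun b r₀ c₀) r c := by
  have h {m n : ℕ} (hn : n < 2 ^ a) : (m * 2 ^ a + n) / 2 ^ a = m := by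
    rw [mul_comm, Nat.mul_add_div (by positivity), Nat.div_eq_of_lt hn, add_zero]
  rw [Tfun, superE_add, superE_add_mul, h hr, h hc, Tfun]

/-- A copy of `T_k` with a lot of room to its left, to its right and below it. -/
theorem Tfun_add_four {k r c : ℕ} (hr : r < 2 ^ k) (hc : c < 2 ^ k) :
    Tfun (k + 4) r (3 * 2 ^ k + c) = Tfun k r c := by
  have h := Tfun_add 4 0 3 hr hc
  rwa [zero_mul, zero_add, show Tfun 4 0 3 = .N from rfl] at h

/-- Positions `(k, r, c)` in the arrays `T_k` such that the `d×d` window with upper-left corner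
`(r, c + 1)` lies in `T_k`. -/
def dom (d : ℕ) : Set (ℕ × ℕ × ℕ) :=
  {p | p.2.1 + d ≤ 2 ^ p.1 ∧ p.2.2 + 1 + d ≤ 2 ^ p.1}

/-- The letter at offset `(a, b)` from a position. -/
def cell (p : ℕ × ℕ × ℕ) (a b : ℕ) : A16 := Tfun p.1 (p.2.1 + a) (p.2.2 + b)

/-- The `d×d` window at a position. -/
def win (d : ℕ) (p : ℕ × ℕ × ℕ) : Pat A16 d d := fun a b => cell p a (1 + b)

/-- The bottom label of the letter to the left of the lower-left corner of the window. -/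
def ext (d : ℕ) (p : ℕ × ℕ × ℕ) : Bool := bot (cell p (d - 1) 0)

/-- The part of `μ` of the neighbourhood of a position that `Pij (i + 1) (j + 1) m n` sees. -/
def obs (i j m n : ℕ) (p : ℕ × ℕ × ℕ) : Pat A16 m n := fun a b =>
  muE (cell p ((i + a) / 2) (1 - j + (j + b) / 2)) (i + a) (j + b)

theorem win_eq_iff {d : ℕ} {p q : ℕ × ℕ × ℕ} :
    win d p = win d q ↔ ∀ a < d, ∀ b < d, cell p a (1 + b) = cell q a (1 + b) :=
  ⟨fun h a ha b hb => congr_fun (congr_fun h ⟨a, ha⟩) ⟨b, hb⟩,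
    fun h => funext fun a => funext fun b => h a a.2 b b.2⟩

theorem Pij_eq_image_obs {i j m n d : ℕ} (hi : i ≤ 1) (hj : j ≤ 1) (hd : 1 ≤ d) (hdm : d ≤ m)
    (hdn : d + j ≤ n) (hm : i + m ≤ 2 * d) (hn : j + n ≤ 2 * (d + j)) :
    Pij (i + 1) (j + 1) m n = obs i j m n '' dom d := by
  ext q
  constructor
  · rintro ⟨x, hx, hq⟩
    obtain ⟨k, r, c, hr, hc, hx⟩ := Set.mem_iUnion.1 hx
    refine ⟨(k + 4, r, 3 * 2 ^ k + c + j - 1), ?_, ?_⟩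
    · simp only [dom, Set.mem_ofPred_eq, pow_add]
      omega
    · funext a b
      have hk : 0 < 2 ^ k := by positivity
      rw [hq, muPatE, dif_pos (by omega), dif_pos (by omega), hx, obs, cell]
      simp only [Nat.add_sub_cancel]
      rw [Nat.mod_eq_of_lt (show (i + a) / 2 < m by omega),
        Nat.mod_eq_of_lt (show (j + b) / 2 < n by omega),
        ← Tfun_add_four (k := k) (by omega) (by omega)]
      congr 2
      omega
  · rintro ⟨⟨k, r, c⟩, ⟨hr, hc⟩, rfl⟩
    dsimp only at hr hc
    refine ⟨fun a b => Tfun (k + 4) (r + a) (3 * 2 ^ k + (c + 1 - j + b)),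
      Set.mem_iUnion.2 ⟨k + 4, r, 3 * 2 ^ k + (c + 1 - j), ?_, ?_, ?_⟩, ?_⟩
    · rw [pow_add]; omega
    · rw [pow_add]; omega
    · intro a b
      rw [add_assoc]
    · intro a b
      rw [muPatE, dif_pos (by omega), dif_pos (by omega), obs, cell]
      simp only [Nat.add_sub_cancel]
      rw [Nat.mod_eq_of_lt (show (i + a) / 2 < m by omega),
        Nat.mod_eq_of_lt (show (j + b) / 2 < n by omega),
        Tfun_add_four (k := k) (by omega) (by omega)]
      congr 2
      omega

theorem level_ne_zero {d : ℕ} {p : ℕ × ℕ × ℕ} (hd : 1 ≤ d) (hp : p ∈ dom d) : p.1 ≠ 0 := by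
  intro h
  have := hp.2
  rw [h] at this
  omega

theorem top_cell {p : ℕ × ℕ × ℕ} (hp : p.1 ≠ 0) (a b : ℕ) :
    top (cell p a b) = decide ((p.2.1 + a) % 2 = 1) := top_Tfun hp _ _

theorem right_cell {p : ℕ × ℕ × ℕ} (hp : p.1 ≠ 0) (a b : ℕ) :
    right (cell p a b) = decide ((p.2.1 + a) % 2 ≠ (p.2.2 + b) % 2) := right_Tfun hp _ _

theorem parity_eq {p q : ℕ × ℕ × ℕ} (hp : p.1 ≠ 0) (hq : q.1 ≠ 0) {a b a' b' : ℕ}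
    (ht : top (cell p a b) = top (cell q a b))
    (hr : right (cell p a' b') = right (cell q a' b')) :
    p.2.1 % 2 = q.2.1 % 2 ∧ p.2.2 % 2 = q.2.2 % 2 := by
  rw [top_cell hp, top_cell hq, decide_eq_decide] at ht
  rw [right_cell hp, right_cell hq, decide_eq_decide] at hr
  omega

theorem top_right_eq {p q : ℕ × ℕ × ℕ} (hp : p.1 ≠ 0) (hq : q.1 ≠ 0)
    (h : p.2.1 % 2 = q.2.1 % 2 ∧ p.2.2 % 2 = q.2.2 % 2) (a b : ℕ) :
    top (cell p a b) = top (cell q a b) ∧ right (cell p a b) = right (cell q a b) := by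
  rw [top_cell hp, top_cell hq, decide_eq_decide, right_cell hp, right_cell hq,
    decide_eq_decide]
  omega

/-- The horizontal labels left of a window are determined by the window and its extension. -/
theorem bot_cell_zero_eq {d : ℕ} {p q : ℕ × ℕ × ℕ} (hp : p ∈ dom d) (hq : q ∈ dom d)
    (hw : win d p = win d q) (he : ext d p = ext d q) {a : ℕ} (ha : a < d) :
    bot (cell p a 0) = bot (cell q a 0) := by
  rw [win_eq_iff] at hw
  rcases Nat.lt_or_ge (a + 1) d with h | h
  · have h₁ := crossing p.1 (p.2.1 + a) p.2.2 (by have := hp.1; omega)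
    have h₂ := crossing q.1 (q.2.1 + a) q.2.2 (by have := hq.1; omega)
    have h₃ := hw a ha 0 (by omega)
    have h₄ := hw (a + 1) h 0 (by omega)
    simp only [cell, add_zero, ← add_assoc] at h₃ h₄ ⊢
    rw [h₃, h₄, ← h₂] at h₁
    simpa using h₁
  · rwa [ext, ext, show d - 1 = a by omega] at he

theorem obs_eq_iff_forall {i j m n d : ℕ} (hm : i + m = 2 * d) {p q : ℕ × ℕ × ℕ} :
    obs i j m n p = obs i j m n q ↔ ∀ R C, i ≤ R → R < 2 * d → j ≤ C → C < j + n →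
      muE (cell p (R / 2) (1 - j + C / 2)) R C = muE (cell q (R / 2) (1 - j + C / 2)) R C := by
  constructor
  · intro h R C hR hR' hC hC'
    have := congr_fun (congr_fun h ⟨R - i, by omega⟩) ⟨C - j, by omega⟩
    simpa only [obs, Nat.add_sub_cancel' hR, Nat.add_sub_cancel' hC] using this
  · intro h
    funext a b
    exact h _ _ (by omega) (by omega) (by omega) (by omega)

theorem win_eq_of_obs_eq {i j m n d : ℕ} (hi : i ≤ 1) (hj : j ≤ 1) (hd : i + 1 ≤ d)
    (hm : i + m = 2 * d) (hn : 2 * d ≤ n + i) (hnj : 2 * d + j ≤ n + 1)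
    {p q : ℕ × ℕ × ℕ}
    (hp : p ∈ dom d) (hq : q ∈ dom d) (h : obs i j m n p = obs i j m n q) :
    win d p = win d q := by
  rw [obs_eq_iff_forall hm] at h
  have hp' := level_ne_zero (by omega) hp
  have hq' := level_ne_zero (by omega) hq
  have ht := congr_arg bot (h (2 * i) (2 * j) (by omega) (by omega) (by omega) (by omega))
  have hr := congr_arg left (h 1 1 (by omega) (by omega) (by omega) (by omega))
  simp only [bot_muE, left_muE, Nat.mul_mod_right] at ht hr
  have hpar := parity_eq hp' hq' (by simpa using ht) (by simpa using hr)
  rw [win_eq_iff]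
  intro a ha b hb
  have hc := h (2 * a + 1) (2 * (b + j)) (by omega) (by omega) (by omega) (by omega)
  rw [show (2 * a + 1) / 2 = a by omega, show 1 - j + 2 * (b + j) / 2 = 1 + b by omega] at hc
  have hb := congr_arg bot hc
  have hl := congr_arg left hc
  simp only [bot_muE, left_muE, Nat.mul_mod_right, Nat.mul_add_mod] at hb hl
  obtain ⟨h₁, h₂⟩ := top_right_eq hp' hq' hpar a (1 + b)
  exact letter_ext (by simpa using hl) h₂ h₁ (by simpa using hb)

theorem obs_zero_eq_iff {i m d : ℕ} (hi : i ≤ 1) (hd : i + 1 ≤ d) (hm : i + m = 2 * d)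
    {p q : ℕ × ℕ × ℕ} (hp : p ∈ dom d) (hq : q ∈ dom d) :
    obs i 0 m m p = obs i 0 m m q ↔ win d p = win d q := by
  refine ⟨win_eq_of_obs_eq hi zero_le_one hd hm (by omega) (by omega) hp hq, ?_⟩
  intro h
  rw [win_eq_iff] at h
  rw [obs_eq_iff_forall hm]
  intro R C _ hR _ hC
  rw [h _ (by omega) _ (by omega)]

theorem obs_one_eq_iff {i m d : ℕ} (hi : i ≤ 1) (hd : i + 1 ≤ d) (hm : i + m = 2 * d)
    {p q : ℕ × ℕ × ℕ} (hp : p ∈ dom d) (hq : q ∈ dom d) :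
    obs i 1 m (i + m) p = obs i 1 m (i + m) q ↔
      (win d p, ext d p) = (win d q, ext d q) := by
  rw [Prod.mk.injEq]
  constructor
  · intro h
    refine ⟨win_eq_of_obs_eq hi le_rfl hd hm (by omega) (by omega) hp hq h, ?_⟩
    rw [obs_eq_iff_forall hm] at h
    have := congr_arg bot (h (2 * (d - 1) + 1) 1 (by omega) (by omega) (by omega) (by omega))
    rw [show (2 * (d - 1) + 1) / 2 = d - 1 by omega] at this
    simpa [bot_muE, ext] using this
  · rintro ⟨hw, he⟩
    have hp' := level_ne_zero (by omega) hp
    have hq' := level_ne_zero (by omega) hq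
    have h := win_eq_iff.1 hw
    have h₀ := h 0 (by omega) 0 (by omega)
    have hpar := parity_eq hp' hq' (congr_arg top h₀) (congr_arg right h₀)
    rw [obs_eq_iff_forall hm]
    intro R C _ hR hC hC'
    rcases Nat.lt_or_ge C 2 with hC₂ | hC₂
    · obtain rfl : C = 1 := by omega
      obtain ⟨h₁, h₂⟩ := top_right_eq hp' hq' hpar (R / 2) 0
      exact muE_congr_of_odd rfl h₂ h₁ (bot_cell_zero_eq hp hq hw he (by omega))
    · have := h (R / 2) (by omega) (C / 2 - 1) (by omega)
      rw [show 1 + (C / 2 - 1) = 1 - 1 + C / 2 by omega] at this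
      rw [this]

/-- The letters `G`, `H`, `O`, `P`, which `μ` reproduces in the lower-left corner. -/
def corners : Set A16 := {.G, .H, .O, .P}

theorem mem_corners_of {x : A16} (hr : right x = true) (ht : top x = true) : x ∈ corners := by
  cases x <;> simp_all [corners, right, top]

theorem superE_corner {x : A16} (hx : x ∈ corners) (K : ℕ) : superE K x (2 ^ K - 1) 0 = x := by
  induction K with
  | zero => rfl
  | succ K ih =>
    have hK : 0 < 2 ^ K := by positivity
    rw [superE, show (2 ^ (K + 1) - 1) / 2 = 2 ^ K - 1 by rw [pow_succ]; omega, ih,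
      muE_congr_mod x (r' := 1) (c' := 0) (by rw [pow_succ]; omega) rfl]
    rcases hx with rfl | rfl | rfl | rfl <;> rfl

theorem bot_superE (x : A16) (K c : ℕ) : bot (superE K x (2 ^ K - 1) c) = bot x := by
  induction K generalizing c with
  | zero => rfl
  | succ K ih =>
    have hK : 0 < 2 ^ K := by positivity
    rw [superE, show (2 ^ (K + 1) - 1) / 2 = 2 ^ K - 1 by rw [pow_succ]; omega, bot_muE,
      if_pos (by rw [pow_succ]; omega), ih]

theorem even_of_ext_ne {d : ℕ} (hd : 1 ≤ d) {p q : ℕ × ℕ × ℕ} (hp : p ∈ dom d) (hq : q ∈ dom d)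
    (hw : win d p = win d q) (he : ext d p ≠ ext d q) :
    (p.2.1 + d) % 2 = 0 ∧ (p.2.2 + 1) % 2 = 0 ∧
      (q.2.1 + d) % 2 = 0 ∧ (q.2.2 + 1) % 2 = 0 := by
  have hp' := level_ne_zero hd hp
  have hq' := level_ne_zero hd hq
  have h := win_eq_iff.1 hw
  have h₀ := h 0 (by omega) 0 (by omega)
  have hpar := parity_eq hp' hq' (congr_arg top h₀) (congr_arg right h₀)
  have hb := congr_arg bot (h (d - 1) (by omega) 0 (by omega))
  simp only [cell, ext, add_zero, zero_add, add_comm 1] at hb he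
  by_contra! hcon
  rcases Nat.mod_two_eq_zero_or_one (p.2.1 + (d - 1)) with hr | hr
  · rw [bot_Tfun_succ_col_of_even hp' hr, bot_Tfun_succ_col_of_even hq' (by omega)] at hb
    exact he (by simpa using hb)
  · rw [bot_Tfun_succ_col_of_odd hp' hr (by omega),
      bot_Tfun_succ_col_of_odd hq' (by omega) (by omega)] at hb
    exact he hb

/-- Desubstitution of a window whose lower-left corner has even coordinates. -/
theorem exists_half {d : ℕ} (hd : 1 ≤ d) {p : ℕ × ℕ × ℕ} (hp : p ∈ dom d)
    (hρ : (p.2.1 + d) % 2 = 0) (hc : (p.2.2 + 1) % 2 = 0) :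
    ∃ p' ∈ dom ((d + 1) / 2), ∀ a b,
      cell p a b = muE (cell p' ((a + d % 2) / 2) ((1 + b) / 2)) (a + d) (1 + b) := by
  have hp' := level_ne_zero hd hp
  obtain ⟨k, r, c⟩ := p
  obtain ⟨k, rfl⟩ := Nat.exists_eq_succ_of_ne_zero hp'
  obtain ⟨h₁, h₂⟩ := hp
  rw [pow_succ] at h₁ h₂
  dsimp only at *
  refine ⟨(k, (r + d) / 2 - (d + 1) / 2, c / 2), ⟨?_, ?_⟩, fun a b => ?_⟩
  · dsimp only; omega
  · dsimp only; omega
  · simp only [cell, Nat.succ_eq_add_one, Tfun_succ]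
    rw [show (r + a) / 2 = (r + d) / 2 - (d + 1) / 2 + (a + d % 2) / 2 by omega,
      show (c + b) / 2 = c / 2 + (1 + b) / 2 by omega]
    exact muE_congr_mod _ (by omega) (by omega)

theorem cell_corner_of_ext_ne {p q : ℕ × ℕ × ℕ} (hp : p ∈ dom 1) (hq : q ∈ dom 1)
    (hw : win 1 p = win 1 q) (he : ext 1 p ≠ ext 1 q) : cell p 0 1 ∈ corners := by
  obtain ⟨hρ, hc, -⟩ := even_of_ext_ne le_rfl hp hq hw he
  have hp' := level_ne_zero le_rfl hp
  apply mem_corners_of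
  · rw [right_cell hp', decide_eq_true_iff]; omega
  · rw [top_cell hp', decide_eq_true_iff]; omega

/-- A window that does not determine its extension lies at the lower-left corner of a
supertile of one of the letters `G`, `H`, `O`, `P`. -/
theorem exists_corner_of_ext_ne (K : ℕ) {d : ℕ} (hd : 1 ≤ d) (hdK : d ≤ 2 ^ K)
    {p q : ℕ × ℕ × ℕ} (hp : p ∈ dom d) (hq : q ∈ dom d) (hw : win d p = win d q)
    (he : ext d p ≠ ext d q) :
    ∃ x ∈ corners, ∀ a < d, ∀ b < d, cell p a (1 + b) = superE K x (2 ^ K - d + a) b := by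
  induction K generalizing d p q with
  | zero =>
    obtain rfl : d = 1 := by simpa using hdK.antisymm hd
    refine ⟨_, cell_corner_of_ext_ne hp hq hw he, fun a ha b hb => ?_⟩
    obtain rfl : a = 0 := by omega
    obtain rfl : b = 0 := by omega
    rfl
  | succ K ih =>
    rcases hd.eq_or_lt with rfl | hd₂
    · have hx := cell_corner_of_ext_ne hp hq hw he
      refine ⟨_, hx, fun a ha b hb => ?_⟩
      obtain rfl : a = 0 := by omega
      obtain rfl : b = 0 := by omega
      exact (superE_corner hx _).symm
    obtain ⟨hρ, hc, hρ', hc'⟩ := even_of_ext_ne hd hp hq hw he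
    obtain ⟨p', hp₁, hcp⟩ := exists_half hd hp hρ hc
    obtain ⟨q', hq₁, hcq⟩ := exists_half hd hq hρ' hc'
    have hp₂ := level_ne_zero (by omega) hp₁
    have hq₂ := level_ne_zero (by omega) hq₁
    have h := win_eq_iff.1 hw
    simp only [hcp, hcq] at h
    have ht := congr_arg bot (h (d - 2) (by omega) 0 (by omega))
    have hr := congr_arg left (h (d - 2) (by omega) 1 (by omega))
    simp only [bot_muE, left_muE, show ¬(d - 2 + d) % 2 = 1 by omega, if_false] at ht hr
    have hpar := parity_eq hp₂ hq₂ (by simpa using ht) (by simpa using hr)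
    rw [pow_succ] at hdK
    have hw' : win ((d + 1) / 2) p' = win ((d + 1) / 2) q' := by
      rw [win_eq_iff]
      intro a ha b hb
      have hc := h (2 * a + 1 - d % 2) (by omega) (2 * b) (by omega)
      rw [show (2 * a + 1 - d % 2 + d % 2) / 2 = a by omega,
        show (1 + (1 + 2 * b)) / 2 = 1 + b by omega] at hc
      have hb := congr_arg bot hc
      have hl := congr_arg left hc
      simp only [bot_muE, left_muE, show (2 * a + 1 - d % 2 + d) % 2 = 1 by omega,
        show (1 + (1 + 2 * b)) % 2 = 0 by omega, if_true] at hb hl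
      obtain ⟨h₁, h₂⟩ := top_right_eq hp₂ hq₂ hpar a (1 + b)
      exact letter_ext hl h₂ h₁ hb
    have he' : ext ((d + 1) / 2) p' ≠ ext ((d + 1) / 2) q' := by
      rw [ext, ext, hcp, hcq, bot_muE, bot_muE, if_pos (by omega), if_pos (by omega),
        show (d - 1 + d % 2) / 2 = (d + 1) / 2 - 1 by omega] at he
      exact he
    obtain ⟨x, hx, hcan⟩ := ih (by omega) (by omega) hp₁ hq₁ hw' he'
    refine ⟨x, hx, fun a ha b hb => ?_⟩
    rw [hcp, show (1 + (1 + b)) / 2 = 1 + b / 2 by omega, hcan _ (by omega) _ (by omega),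
      superE, show (2 ^ (K + 1) - d + a) / 2 = 2 ^ K - (d + 1) / 2 + (a + d % 2) / 2 by
        rw [pow_succ]; omega]
    exact muE_congr_mod _ (by rw [pow_succ]; omega) (by omega)

/-- The window at the lower-left corner of a large supertile of `x`. -/
def cornerPat (d : ℕ) (x : A16) : Pat A16 d d := fun a b => superE d x (2 ^ d - d + a) b

theorem cornerPat_injOn {d : ℕ} (hd : 1 ≤ d) : Set.InjOn (cornerPat d) corners := by
  intro x hx y hy h
  have hlt : d < 2 ^ d := Nat.lt_two_pow_self
  have := congr_fun (congr_fun h ⟨d - 1, by omega⟩) ⟨0, by omega⟩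
  simpa only [cornerPat, show 2 ^ d - d + (d - 1) = 2 ^ d - 1 by omega, superE_corner hx,
    superE_corner hy] using this

theorem exists_corner_neighbour {x : A16} (hx : x ∈ corners) (v : Bool) :
    ∃ r c, r < 16 ∧ c + 1 < 16 ∧ Tfun 4 r (c + 1) = x ∧ bot (Tfun 4 r c) = v := by
  rcases hx with rfl | rfl | rfl | rfl <;> cases v
  · exact ⟨3, 1, by decide, by decide, rfl, rfl⟩
  · exact ⟨1, 3, by decide, by decide, rfl, rfl⟩
  · exact ⟨1, 1, by decide, by decide, rfl, rfl⟩
  · exact ⟨7, 13, by decide, by decide, rfl, rfl⟩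
  · exact ⟨7, 1, by decide, by decide, rfl, rfl⟩
  · exact ⟨1, 7, by decide, by decide, rfl, rfl⟩
  · exact ⟨1, 5, by decide, by decide, rfl, rfl⟩
  · exact ⟨3, 5, by decide, by decide, rfl, rfl⟩

theorem cornerPat_mem_image {d : ℕ} (hd : 1 ≤ d) {x : A16} (hx : x ∈ corners) (v : Bool) :
    (cornerPat d x, v) ∈ (fun p => (win d p, ext d p)) '' dom d := by
  obtain ⟨r, c, hr, hc, rfl, rfl⟩ := exists_corner_neighbour hx v
  have hlt : d < 2 ^ d := Nat.lt_two_pow_self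
  refine ⟨(d + 4, r * 2 ^ d + (2 ^ d - d), c * 2 ^ d + (2 ^ d - 1)), ⟨?_, ?_⟩, ?_⟩
  · have := Nat.mul_le_mul_right (2 ^ d) (show r + 1 ≤ 16 by omega)
    simp only [pow_add]
    lia
  · have := Nat.mul_le_mul_right (2 ^ d) (show c + 2 ≤ 16 by omega)
    simp only [pow_add]
    lia
  · refine Prod.ext (funext fun a => funext fun b => ?_) ?_
    · simp only [cornerPat]
      rw [← Tfun_add 4 r (c + 1) (by omega) (by omega)]
      simp only [win, cell]
      congr 1
      · ring
      · rw [add_mul]; omega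
    · simp only [ext, cell]
      rw [← bot_superE (Tfun 4 r c) d (2 ^ d - 1), ← Tfun_add 4 r c (by omega) (by omega)]
      congr 2
      omega

theorem ncard_image_eq_of_ker_eq {α β γ : Type*} {s : Set α} {f : α → β} {g : α → γ}
    (h : ∀ a ∈ s, ∀ b ∈ s, f a = f b ↔ g a = g b) : (f '' s).ncard = (g '' s).ncard := by
  have hf : Set.InjOn Prod.fst ((fun a => (f a, g a)) '' s) := by
    rintro _ ⟨a, ha, rfl⟩ _ ⟨b, hb, rfl⟩ hab
    exact Prod.ext hab ((h a ha b hb).1 hab)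
  have hg : Set.InjOn Prod.snd ((fun a => (f a, g a)) '' s) := by
    rintro _ ⟨a, ha, rfl⟩ _ ⟨b, hb, rfl⟩ hab
    exact Prod.ext ((h a ha b hb).2 hab) hab
  have hf' := hf.ncard_image
  have hg' := hg.ncard_image
  rw [Set.image_image] at hf' hg'
  exact hf'.trans hg'.symm

theorem ncard_prod_bool {α : Type*} [Finite α] (V : Set (α × Bool)) :
    V.ncard = (Prod.fst '' V).ncard + {w | (w, true) ∈ V ∧ (w, false) ∈ V}.ncard := by
  have hV : V = (fun w => (w, true)) '' {w | (w, true) ∈ V} ∪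
      (fun w => (w, false)) '' {w | (w, false) ∈ V} := by
    ext ⟨w, v⟩
    cases v <;> simp
  have hfst : Prod.fst '' V = {w | (w, true) ∈ V} ∪ {w | (w, false) ∈ V} := by
    ext w
    simp [or_comm]
  have hdisj : Disjoint ((fun w => (w, true)) '' {w | (w, true) ∈ V})
      ((fun w => (w, false)) '' {w | (w, false) ∈ V}) := by
    rw [Set.disjoint_left]
    rintro _ ⟨w, _, rfl⟩ ⟨w', _, h⟩
    simp at h
  conv_lhs => rw [hV]
  rw [hfst, Set.ncard_union_eq hdisj, Set.ncard_image_of_injective _ (Prod.mk_left_injective _),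
    Set.ncard_image_of_injective _ (Prod.mk_left_injective _), ← Set.ncard_union_add_ncard_inter]
  rfl

theorem ncard_win_add_four {d : ℕ} (hd : 1 ≤ d) :
    (win d '' dom d).ncard + 4 = ((fun p => (win d p, ext d p)) '' dom d).ncard := by
  have hamb : {w | (w, true) ∈ (fun p => (win d p, ext d p)) '' dom d ∧
      (w, false) ∈ (fun p => (win d p, ext d p)) '' dom d} = cornerPat d '' corners := by
    ext w
    constructor
    · rintro ⟨⟨p, hp, hpw⟩, ⟨q, hq, hqw⟩⟩
      rw [Prod.mk.injEq] at hpw hqw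
      obtain ⟨x, hx, h⟩ := exists_corner_of_ext_ne d hd Nat.lt_two_pow_self.le hp hq
        (hpw.1.trans hqw.1.symm) (by rw [hpw.2, hqw.2]; decide)
      refine ⟨x, hx, ?_⟩
      rw [← hpw.1]
      exact funext fun a => funext fun b => (h a a.2 b b.2).symm
    · rintro ⟨x, hx, rfl⟩
      exact ⟨cornerPat_mem_image hd hx true, cornerPat_mem_image hd hx false⟩
  have hcard : corners.ncard = 4 := by
    have : corners = ({.G, .H, .O, .P} : Finset A16) := by simp [corners]
    rw [this, Set.ncard_coe_finset]
    rfl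
  rw [ncard_prod_bool, hamb, (cornerPat_injOn hd).ncard_image, hcard,
    Set.image_image]

theorem ncard_obs_add_four {i m d : ℕ} (hi : i ≤ 1) (hd : i + 1 ≤ d) (hm : i + m = 2 * d) :
    (obs i 0 m m '' dom d).ncard + 4 = (obs i 1 m (i + m) '' dom d).ncard := by
  rw [ncard_image_eq_of_ker_eq fun p hp q hq => obs_zero_eq_iff hi hd hm hp hq,
    ncard_image_eq_of_ker_eq fun p hp q hq => obs_one_eq_iff hi hd hm hp hq,
    ncard_win_add_four (by omega)]

end PlusFour

/-- Lemma 5.2: a_{1,1}(2n) + 4 = a_{1,2}(2n) and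
a_{2,1}(2n+1) + 4 = b_{2,2}(2n+1). -/
theorem plus_four (n : ℕ) (hn : 1 ≤ n) :
    aT 1 1 (2 * n) + 4 = aT 1 2 (2 * n) ∧
    aT 2 1 (2 * n + 1) + 4 = bT 2 2 (2 * n + 1) := by
  simp only [aT, bT, Nat.card_coe_set_eq]
  constructor
  · rw [PlusFour.Pij_eq_image_obs (i := 0) (j := 0) (d := n),
      PlusFour.Pij_eq_image_obs (i := 0) (j := 1) (d := n)]
    · have h := PlusFour.ncard_obs_add_four (i := 0) (m := 2 * n) zero_le_one hn (zero_add _)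
      rwa [zero_add] at h
    all_goals omega
  · rw [PlusFour.Pij_eq_image_obs (i := 1) (j := 0) (d := n + 1),
      PlusFour.Pij_eq_image_obs (i := 1) (j := 1) (d := n + 1)]
    · rw [PlusFour.ncard_obs_add_four (d := n + 1) le_rfl (by omega) (by omega),
        add_comm 1 (2 * n + 1)]
    all_goals omega
end

section
/- For every integer n ≥ 3, A_{2n} = 4·A_n + 12. -/
/-- The high bit of the paperfolding array on the quadrant `ℕ × ℕ`. -/
def foldHi (r c : ℕ) : ℕ :=
  if c = 0 then 0 else if c % 2 = 1 then (r / 2 + c / 2) % 2 else foldHi (r / 2) (c / 2)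
termination_by c
decreasing_by omega

/-- The low bit of the paperfolding array on the quadrant `ℕ × ℕ`. -/
def foldLo (r c : ℕ) : ℕ :=
  if r % 2 = 0 then (r / 2 + c) % 2 else foldLo (r / 2) (c / 2)
termination_by r
decreasing_by omega

theorem foldHi_odd (r : ℕ) {c : ℕ} (h : c % 2 = 1) : foldHi r c = (r / 2 + c / 2) % 2 := by
  rw [foldHi, if_neg (by omega), if_pos h]

theorem foldHi_even (r : ℕ) {c : ℕ} (h : c % 2 = 0) : foldHi r c = foldHi (r / 2) (c / 2) := by
  by_cases hc : c = 0
  · subst hc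
    simp [foldHi]
  · rw [foldHi, if_neg hc, if_neg (by omega)]

theorem foldLo_even {r : ℕ} (c : ℕ) (h : r % 2 = 0) : foldLo r c = (r / 2 + c) % 2 := by
  rw [foldLo, if_pos h]

theorem foldLo_odd {r : ℕ} (c : ℕ) (h : r % 2 = 1) : foldLo r c = foldLo (r / 2) (c / 2) := by
  rw [foldLo, if_neg (by omega)]

theorem foldHi_even_iff {r c r' c' : ℕ} (h : c % 2 = 0) (h' : c' % 2 = 0) :
    foldHi r c = foldHi r' c' ↔ foldHi (r / 2) (c / 2) = foldHi (r' / 2) (c' / 2) := by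
  rw [foldHi_even _ h, foldHi_even _ h']

theorem foldHi_odd_iff {r c r' c' : ℕ} (h : c % 2 = 1) (h' : c' % 2 = 1) :
    foldHi r c = foldHi r' c' ↔ (r / 2 + c / 2) % 2 = (r' / 2 + c' / 2) % 2 := by
  rw [foldHi_odd _ h, foldHi_odd _ h']

theorem foldLo_even_iff {r c r' c' : ℕ} (h : r % 2 = 0) (h' : r' % 2 = 0) :
    foldLo r c = foldLo r' c' ↔ (r / 2 + c) % 2 = (r' / 2 + c') % 2 := by
  rw [foldLo_even _ h, foldLo_even _ h']

theorem foldLo_odd_iff {r c r' c' : ℕ} (h : r % 2 = 1) (h' : r' % 2 = 1) :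
    foldLo r c = foldLo r' c' ↔ foldLo (r / 2) (c / 2) = foldLo (r' / 2) (c' / 2) := by
  rw [foldLo_odd _ h, foldLo_odd _ h']

theorem foldHi_lt (r c : ℕ) : foldHi r c < 2 := by
  induction c using Nat.strong_induction_on generalizing r with
  | _ c ih =>
    rw [foldHi]
    split_ifs
    · omega
    · omega
    · exact ih _ (by omega) _

theorem foldLo_lt (r c : ℕ) : foldLo r c < 2 := by
  induction r using Nat.strong_induction_on generalizing c with
  | _ r ih =>
    rw [foldLo]
    split_ifs
    · omega
    · exact ih _ (by omega) _

/-- At every interior vertex exactly one of the high bit (vertically) and the low bit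
(horizontally) flips. -/
theorem vertex_relation (r c : ℕ) :
    (foldHi (r + 1) (c + 1) + foldHi r (c + 1) + foldLo r c + foldLo r (c + 1)) % 2 = 1 := by
  induction r using Nat.strong_induction_on generalizing c with
  | _ r ih =>
    obtain hr | hr := Nat.mod_two_eq_zero_or_one r
    · have hhi : foldHi (r + 1) (c + 1) = foldHi r (c + 1) := by
        obtain hc | hc := Nat.mod_two_eq_zero_or_one (c + 1)
        · rw [foldHi_even _ hc, foldHi_even _ hc, show (r + 1) / 2 = r / 2 by omega]
        · rw [foldHi_odd _ hc, foldHi_odd _ hc, show (r + 1) / 2 = r / 2 by omega]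
      rw [hhi, foldLo_even _ hr, foldLo_even _ hr]
      omega
    · rw [foldLo_odd _ hr, foldLo_odd _ hr]
      obtain hc | hc := Nat.mod_two_eq_zero_or_one (c + 1)
      · rw [foldHi_even _ hc, foldHi_even _ hc, show (r + 1) / 2 = r / 2 + 1 by omega,
          show (c + 1) / 2 = c / 2 + 1 by omega]
        exact ih _ (by omega) _
      · rw [foldHi_odd _ hc, foldHi_odd _ hc, show (c + 1) / 2 = c / 2 by omega]
        omega

/-- The symbol of the paperfolding array at row `r` and column `c`. -/
def foldSym (r c : ℕ) : Fin 4 :=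
  ⟨2 * foldHi r c + foldLo r c, by have := foldHi_lt r c; have := foldLo_lt r c; omega⟩

theorem foldSym_eq_iff {r c r' c' : ℕ} :
    foldSym r c = foldSym r' c' ↔ foldHi r c = foldHi r' c' ∧ foldLo r c = foldLo r' c' := by
  have := foldHi_lt r c
  have := foldLo_lt r c
  have := foldHi_lt r' c'
  have := foldLo_lt r' c'
  simp only [foldSym, Fin.mk.injEq]
  omega

/-! ### Patterns of `S` are windows of the paperfolding array -/

theorem phi_mu_hi (x : A16) (a b d e : Fin 2) :
    (phi (mu x a b) d e).val / 2 =
      if e.val = 1 then (a.val + b.val) % 2 else (phi x a b).val / 2 := by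
  cases x <;> revert a b d e <;> decide

theorem phi_mu_lo (x : A16) (a b d e : Fin 2) :
    (phi (mu x a b) d e).val % 2 =
      if d.val = 0 then (a.val + e.val) % 2 else (phi x a b).val % 2 := by
  cases x <;> revert a b d e <;> decide

theorem Sfun_succ_hi (k r c : ℕ) :
    (Sfun (k + 1) r c).val / 2 =
      if c % 2 = 1 then (r / 2 + c / 2) % 2 else (Sfun k (r / 2) (c / 2)).val / 2 :=
  (phi_mu_hi _ _ _ _ _).trans (by rw [Nat.add_mod (r / 2)]; rfl)

theorem Sfun_succ_lo (k r c : ℕ) :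
    (Sfun (k + 1) r c).val % 2 =
      if r % 2 = 0 then (r / 2 + c) % 2 else (Sfun k (r / 2) (c / 2)).val % 2 :=
  (phi_mu_lo _ _ _ _ _).trans (by rw [Nat.add_mod (r / 2)]; rfl)

theorem Sfun_hi {k r c : ℕ} (h : ¬ 2 ^ k ∣ c) : (Sfun k r c).val / 2 = foldHi r c := by
  induction k generalizing r c with
  | zero => simp at h
  | succ k ih =>
    rw [Sfun_succ_hi]
    obtain hc | hc := Nat.mod_two_eq_zero_or_one c
    · rw [if_neg (by omega), foldHi_even _ hc]
      refine ih fun hd => h ?_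
      have := Nat.mul_dvd_mul_right hd 2
      rwa [← pow_succ, Nat.div_mul_cancel (Nat.dvd_of_mod_eq_zero hc)] at this
    · rw [if_pos hc, foldHi_odd _ hc]

theorem Sfun_lo {k r c : ℕ} (h : ¬ 2 ^ k ∣ r + 1) : (Sfun k r c).val % 2 = foldLo r c := by
  induction k generalizing r c with
  | zero => simp at h
  | succ k ih =>
    rw [Sfun_succ_lo]
    obtain hr | hr := Nat.mod_two_eq_zero_or_one r
    · rw [if_pos hr, foldLo_even _ hr]
    · rw [if_neg (by omega), foldLo_odd _ hr]
      refine ih fun hd => h ?_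
      have := Nat.mul_dvd_mul_right hd 2
      rwa [← pow_succ, show (r / 2 + 1) * 2 = r + 1 by omega] at this

theorem Sfun_eq_foldSym {k r c : ℕ} (hr : ¬ 2 ^ k ∣ r + 1) (hc : ¬ 2 ^ k ∣ c) :
    Sfun k r c = foldSym r c := by
  have h₁ := Sfun_hi (r := r) hc
  have h₂ := Sfun_lo (c := c) hr
  ext
  simp only [foldSym]
  omega

/-- Each supertile recurs two levels further up, in its top right corner. -/
theorem Sfun_add_two {k r c : ℕ} (hr : r < 2 ^ (k + 1)) (hc : c < 2 ^ (k + 1)) :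
    Sfun (k + 2) r (3 * 2 ^ (k + 1) + c) = Sfun k r c := by
  induction k generalizing r c with
  | zero =>
    norm_num at hr hc
    interval_cases r <;> interval_cases c <;> rfl
  | succ k ih =>
    have hp : 2 ^ (k + 1 + 1) = 2 * 2 ^ (k + 1) := by ring
    have he : 2 ^ (k + 1) = 2 * 2 ^ k := by ring
    have hdiv : (3 * 2 ^ (k + 1 + 1) + c) / 2 = 3 * 2 ^ (k + 1) + c / 2 := by omega
    have := ih (r := r / 2) (c := c / 2) (by omega) (by omega)
    have h₁ := Sfun_succ_hi (k + 2) r (3 * 2 ^ (k + 1 + 1) + c)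
    have h₂ := Sfun_succ_lo (k + 2) r (3 * 2 ^ (k + 1 + 1) + c)
    have h₃ := Sfun_succ_hi k r c
    have h₄ := Sfun_succ_lo k r c
    rw [hdiv, this] at h₁ h₂
    rw [show k + 1 + 2 = k + 2 + 1 by ring]
    ext
    split_ifs at h₁ h₂ h₃ h₄ <;> omega

/-- The `m × n` window of the paperfolding array with top left corner `(r, c)`. -/
def window (m n r c : ℕ) : Pat (Fin 4) m n := fun i j => foldSym (r + i) (c + j)

theorem PS_eq_range (m n : ℕ) :
    PS m n = Set.range fun x : ℕ × ℕ => window m n x.1 (x.2 + 1) := by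
  ext p
  simp only [PS, patIn, Set.mem_iUnion, Set.mem_ofPred_eq, Set.mem_range, Prod.exists]
  constructor
  · rintro ⟨k, r, c, hr, hc, hp⟩
    have hpos : 0 < 2 ^ (k + 1) := by positivity
    refine ⟨r, 3 * 2 ^ (k + 1) + c - 1, ?_⟩
    ext i j : 2
    have hi := i.isLt
    have hj := j.isLt
    have hpow : 2 ^ (k + 2) = 2 * 2 ^ (k + 1) := by ring
    rw [hp, ← Sfun_add_two (by omega) (by omega), Sfun_eq_foldSym, window]
    · congr 1
      omega
    · intro hd
      have := Nat.le_of_dvd (by omega) hd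
      omega
    · rintro ⟨q, hq⟩
      rw [hpow] at hq
      have hlt : 2 * 2 ^ (k + 1) * 1 < 2 * 2 ^ (k + 1) * q := by omega
      have hlt' : 2 * 2 ^ (k + 1) * q < 2 * 2 ^ (k + 1) * 2 := by omega
      have := Nat.lt_of_mul_lt_mul_left hlt
      have := Nat.lt_of_mul_lt_mul_left hlt'
      omega
  · rintro ⟨r, c, rfl⟩
    have hlt := Nat.lt_two_pow_self (n := r + c + m + n + 1)
    have hpow : 2 ^ (r + c + m + n + 1 + 1) = 2 * 2 ^ (r + c + m + n + 1) := by ring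
    refine ⟨r + c + m + n + 1, r, c + 1, by omega, by omega, fun i j => ?_⟩
    have hi := i.isLt
    have hj := j.isLt
    rw [Sfun_eq_foldSym, window]
    · exact Nat.not_dvd_of_pos_of_lt (by omega) (by omega)
    · exact Nat.not_dvd_of_pos_of_lt (by omega) (by omega)

/-! ### Windows with equal content -/

/-- The `n × n` windows at `(r, c)` and `(r', c')` have the same content. -/
def Agree (n r c r' c' : ℕ) : Prop :=
  ∀ a < n, ∀ b < n, foldHi (r + a) (c + b) = foldHi (r' + a) (c' + b) ∧
    foldLo (r + a) (c + b) = foldLo (r' + a) (c' + b)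

theorem window_eq_iff {n r c r' c' : ℕ} :
    window n n r c = window n n r' c' ↔ Agree n r c r' c' := by
  simp only [window, Agree, funext_iff, foldSym_eq_iff, Fin.forall_iff]

theorem Agree.symm {n r c r' c' : ℕ} (h : Agree n r c r' c') : Agree n r' c' r c :=
  fun a ha b hb => ⟨(h a ha b hb).1.symm, (h a ha b hb).2.symm⟩

theorem Agree.row_parity {n r c r' c' : ℕ} (hn : 3 ≤ n) (h : Agree n r c r' c') :
    r % 2 = r' % 2 := by
  have key : ∀ {r c r' c' : ℕ}, Agree n r c r' c' → r % 2 = 0 → r' % 2 = 1 → False := by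
    intro r c r' c' h hr hr'
    have h₀ := (h 0 (by omega) 0 (by omega)).2
    have h₁ := (h 0 (by omega) 1 (by omega)).2
    have h₂ := (h 0 (by omega) 2 (by omega)).2
    simp only [add_zero, foldLo_even _ hr, foldLo_odd _ hr'] at h₀ h₁ h₂
    obtain hc | hc := Nat.mod_two_eq_zero_or_one c'
    · rw [show (c' + 1) / 2 = c' / 2 by omega] at h₁
      omega
    · rw [show (c' + 2) / 2 = (c' + 1) / 2 by omega] at h₂
      omega
  obtain hr | hr := Nat.mod_two_eq_zero_or_one r <;>
    obtain hr' | hr' := Nat.mod_two_eq_zero_or_one r'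
  · omega
  · exact (key h hr hr').elim
  · exact (key h.symm hr' hr).elim
  · omega

theorem foldLo_one_mod_four {r : ℕ} (c : ℕ) (h : r % 4 = 1) :
    foldLo r c = (r / 4 + c / 2) % 2 := by
  rw [foldLo_odd _ (by omega), foldLo_even _ (by omega), Nat.div_div_eq_div_mul]

theorem foldLo_add_one_of_even {r c : ℕ} (hr : r % 2 = 1) (hc : c % 2 = 0) :
    foldLo r (c + 1) = foldLo r c := by
  rw [foldLo_odd _ hr, foldLo_odd _ hr, show (c + 1) / 2 = c / 2 by omega]

theorem Agree.col_parity {n r c r' c' : ℕ} (hn : 3 ≤ n) (h : Agree n r c r' c') :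
    c % 2 = c' % 2 := by
  have key : ∀ {r c r' c' : ℕ}, Agree n r c r' c' → c % 2 = 1 → c' % 2 = 0 → False := by
    intro r c r' c' h hc hc'
    have hr := h.row_parity hn
    have no_left : ∀ a < n, ¬ (r + a) % 4 = 1 := by
      intro a ha hra
      have h₀ := (h a ha 0 (by omega)).2
      have h₁ := (h a ha 1 (by omega)).2
      rw [foldLo_one_mod_four _ hra] at h₀ h₁
      rw [foldLo_add_one_of_even (by omega) hc'] at h₁
      simp only [add_zero] at h₀
      omega
    have no_right : ∀ a < n, ¬ (r' + a) % 4 = 1 := by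
      intro a ha hra
      have h₁ := (h a ha 1 (by omega)).2
      have h₂ := (h a ha 2 (by omega)).2
      rw [foldLo_one_mod_four _ hra] at h₁ h₂
      rw [foldLo_add_one_of_even (c := c + 1) (by omega) (by omega)] at h₂
      omega
    have := no_left 0 (by omega)
    have := no_left 1 (by omega)
    have := no_left 2 (by omega)
    have := no_right 1 (by omega)
    have h₀ := (h 0 (by omega) 0 (by omega)).2
    rw [foldLo_even_iff (by omega) (by omega)] at h₀
    omega
  obtain hr | hr := Nat.mod_two_eq_zero_or_one c <;>
    obtain hr' | hr' := Nat.mod_two_eq_zero_or_one c'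
  · omega
  · exact (key h.symm hr' hr).elim
  · exact (key h hr hr').elim
  · omega

/-- The high bits in the row below a window depend only on the window and on their first one. -/
theorem Agree.foldHi_eq {n r c r' c' : ℕ} (h : Agree n r c r' c')
    (hx : foldHi (r + n) c = foldHi (r' + n) c') {a b : ℕ} (ha : a ≤ n) (hb : b < n) :
    foldHi (r + a) (c + b) = foldHi (r' + a) (c' + b) := by
  obtain ha | rfl := ha.lt_or_eq
  · exact (h a ha b hb).1
  obtain _ | b := b
  · exact hx
  obtain ⟨a, rfl⟩ : ∃ k, a = k + 1 := ⟨a - 1, by omega⟩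
  have h₁ := vertex_relation (r + a) (c + b)
  have h₂ := vertex_relation (r' + a) (c' + b)
  have h₃ := h a (by omega) b (by omega)
  have h₄ := h a (by omega) (b + 1) hb
  have := foldHi_lt (r + (a + 1)) (c + (b + 1))
  have := foldHi_lt (r' + (a + 1)) (c' + (b + 1))
  simp only [← add_assoc] at *
  omega

/-- The low bits in the column left of a window depend only on the window and on the high bit
below its first column. -/
theorem Agree.foldLo_eq {n r c r' c' : ℕ} (h : Agree n r (c + 1) r' (c' + 1))
    (hx : foldHi (r + n) (c + 1) = foldHi (r' + n) (c' + 1)) {a b : ℕ} (ha : a < n)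
    (hb : b ≤ n) : foldLo (r + a) (c + b) = foldLo (r' + a) (c' + b) := by
  obtain _ | b := b
  · have h₁ := vertex_relation (r + a) c
    have h₂ := vertex_relation (r' + a) c'
    have h₃ := h a ha 0 (by omega)
    have h₄ := h.foldHi_eq hx (a := a + 1) (b := 0) ha (by omega)
    have := foldLo_lt (r + a) c
    have := foldLo_lt (r' + a) c'
    simp only [← add_assoc, add_zero] at *
    omega
  · have := (h a ha b (by omega)).2
    rwa [add_right_comm, add_assoc, add_right_comm c', add_assoc c'] at this

/-! ### Desubstitution of windows -/

theorem Agree.of_double {n r c r' c' i j : ℕ} (hi : i < 2) (hj : j < 2)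
    (h : Agree (2 * n) (2 * r + i) (2 * (c + 1) - j) (2 * r' + i) (2 * (c' + 1) - j)) :
    Agree n r (c + 1) r' (c' + 1) := by
  intro a ha b hb
  have h₁ := h (2 * a + 1 - i) (by omega) (2 * b + j) (by omega)
  rw [show 2 * r + i + (2 * a + 1 - i) = 2 * (r + a) + 1 by omega,
    show 2 * r' + i + (2 * a + 1 - i) = 2 * (r' + a) + 1 by omega,
    show 2 * (c + 1) - j + (2 * b + j) = 2 * (c + 1 + b) by omega,
    show 2 * (c' + 1) - j + (2 * b + j) = 2 * (c' + 1 + b) by omega,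
    foldHi_even_iff (by omega) (by omega), foldLo_odd_iff (by omega) (by omega)] at h₁
  convert h₁ using 3 <;> omega

theorem Agree.corner_of_double {n r c r' c' i j : ℕ} (hn : 0 < n) (hi : i < 2) (hj : j < 2)
    (hij : i = 1 ∨ j = 1)
    (h : Agree (2 * n) (2 * r + i) (2 * (c + 1) - j) (2 * r' + i) (2 * (c' + 1) - j)) :
    foldHi (r + n) (c + 1) = foldHi (r' + n) (c' + 1) := by
  by_cases hi1 : i = 1
  · subst hi1
    have h₁ := (h (2 * n - 1) (by omega) j (by omega)).1
    rw [foldHi_even_iff (by omega) (by omega)] at h₁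
    convert h₁ using 2 <;> omega
  · obtain rfl : j = 1 := by omega
    obtain rfl : i = 0 := by omega
    obtain ⟨n, rfl⟩ : ∃ k, n = k + 1 := ⟨n - 1, by omega⟩
    have h₁ := (h (2 * n + 1) (by omega) 0 (by omega)).2
    rw [foldLo_odd_iff (by omega) (by omega),
      show (2 * r + 0 + (2 * n + 1)) / 2 = r + n by omega,
      show (2 * r' + 0 + (2 * n + 1)) / 2 = r' + n by omega,
      show (2 * (c + 1) - 1 + 0) / 2 = c by omega,
      show (2 * (c' + 1) - 1 + 0) / 2 = c' by omega] at h₁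
    have h₂ := h.of_double hi hj n (by omega) 0 (by omega)
    have h₃ := vertex_relation (r + n) c
    have h₄ := vertex_relation (r' + n) c'
    have := foldHi_lt (r + n + 1) (c + 1)
    have := foldHi_lt (r' + n + 1) (c' + 1)
    simp only [← add_assoc, add_zero] at *
    omega

theorem Agree.double {n r c r' c' i j : ℕ} (hn : 3 ≤ n) (hi : i < 2) (hj : j < 2)
    (h : Agree n r (c + 1) r' (c' + 1))
    (hx : i = 1 ∨ j = 1 → foldHi (r + n) (c + 1) = foldHi (r' + n) (c' + 1)) :
    Agree (2 * n) (2 * r + i) (2 * (c + 1) - j) (2 * r' + i) (2 * (c' + 1) - j) := by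
  have hr := h.row_parity hn
  have hc := h.col_parity hn
  intro a ha b hb
  constructor
  · obtain hb2 | hb2 := Nat.mod_two_eq_zero_or_one (j + b)
    · rw [foldHi_even_iff (by omega) (by omega),
        show (2 * r + i + a) / 2 = r + (i + a) / 2 by omega,
        show (2 * r' + i + a) / 2 = r' + (i + a) / 2 by omega,
        show (2 * (c + 1) - j + b) / 2 = c + 1 + b / 2 by omega,
        show (2 * (c' + 1) - j + b) / 2 = c' + 1 + b / 2 by omega]
      by_cases hij : i = 1 ∨ j = 1
      · exact h.foldHi_eq (hx hij) (by omega) (by omega)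
      · exact (h _ (by omega) _ (by omega)).1
    · rw [foldHi_odd_iff (by omega) (by omega)]
      omega
  · obtain ha2 | ha2 := Nat.mod_two_eq_zero_or_one (i + a)
    · rw [foldLo_even_iff (by omega) (by omega)]
      omega
    · rw [foldLo_odd_iff (by omega) (by omega),
        show (2 * r + i + a) / 2 = r + (i + a) / 2 by omega,
        show (2 * r' + i + a) / 2 = r' + (i + a) / 2 by omega,
        show (2 * (c + 1) - j + b) / 2 = c + (2 - j + b) / 2 by omega,
        show (2 * (c' + 1) - j + b) / 2 = c' + (2 - j + b) / 2 by omega]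
      by_cases hij : i = 1 ∨ j = 1
      · exact h.foldLo_eq (hx hij) (by omega) (by omega)
      · have := (h ((i + a) / 2) (by omega) (b / 2) (by omega)).2
        convert this using 2 <;> omega

/-! ### Windows whose extension is ambiguous -/

theorem Agree.half {n r c r' c' : ℕ} (h : Agree n r c r' c') (hr : (r + n) % 2 = 0)
    (hr' : (r' + n) % 2 = 0) (hc : c % 2 = 0) (hc' : c' % 2 = 0) :
    Agree ((n + 1) / 2) (r / 2) (c / 2) (r' / 2) (c' / 2) := by
  intro a ha b hb
  have h₁ := h (2 * a + 1 - r % 2) (by omega) (2 * b) (by omega)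
  rw [foldHi_even_iff (by omega) (by omega), foldLo_odd_iff (by omega) (by omega)] at h₁
  convert h₁ using 3 <;> omega

theorem Agree.of_half {n r c r' c' : ℕ}
    (h : Agree ((n + 1) / 2) (r / 2) (c / 2) (r' / 2) (c' / 2)) (hr : (r + n) % 2 = 0)
    (hrr' : r % 4 = r' % 4) (hc : c % 2 = 0) (hcc' : c % 4 = c' % 4) :
    Agree n r c r' c' := by
  intro a ha b hb
  constructor
  · obtain hb2 | hb2 := Nat.mod_two_eq_zero_or_one b
    · rw [foldHi_even_iff (by omega) (by omega)]
      have := (h ((r % 2 + a) / 2) (by omega) (b / 2) (by omega)).1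
      convert this using 2 <;> omega
    · rw [foldHi_odd_iff (by omega) (by omega)]
      omega
  · obtain ha2 | ha2 := Nat.mod_two_eq_zero_or_one (r + a)
    · rw [foldLo_even_iff (by omega) (by omega)]
      omega
    · rw [foldLo_odd_iff (by omega) (by omega)]
      have := (h ((r % 2 + a) / 2) (by omega) (b / 2) (by omega)).2
      convert this using 2 <;> omega

/-- Two windows with the same content and parity, but different high bits below their bottom left
corners. -/
structure Ambiguous (n r c r' c' : ℕ) : Prop where
  agree : Agree n r c r' c'
  row_parity : r % 2 = r' % 2
  col_parity : c % 2 = c' % 2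
  ne : foldHi (r + n) c ≠ foldHi (r' + n) c'

theorem Ambiguous.even {n r c r' c' : ℕ} (hn : 0 < n) (h : Ambiguous n r c r' c') :
    (r + n) % 2 = 0 ∧ c % 2 = 0 := by
  have hr := h.row_parity
  have hc := h.col_parity
  have hne := h.ne
  obtain hc2 | hc2 := Nat.mod_two_eq_zero_or_one c
  · refine ⟨?_, hc2⟩
    by_contra hrn
    have h₁ := (h.agree (n - 1) (by omega) 0 hn).1
    rw [add_zero, add_zero, foldHi_even_iff hc2 (by omega),
      show (r + (n - 1)) / 2 = (r + n) / 2 by omega,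
      show (r' + (n - 1)) / 2 = (r' + n) / 2 by omega] at h₁
    rw [ne_eq, foldHi_even_iff hc2 (by omega)] at hne
    exact hne h₁
  · have h₁ := (h.agree (n - 1) (by omega) 0 hn).1
    rw [add_zero, add_zero, foldHi_odd_iff hc2 (by omega)] at h₁
    rw [ne_eq, foldHi_odd_iff hc2 (by omega)] at hne
    omega

theorem Ambiguous.half {n r c r' c' : ℕ} (hn : 2 ≤ n) (h : Ambiguous n r c r' c') :
    Ambiguous ((n + 1) / 2) (r / 2) (c / 2) (r' / 2) (c' / 2) := by
  obtain ⟨hr, hc⟩ := h.even (by omega)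
  have hrr := h.row_parity
  have hcc := h.col_parity
  have h₁ := (h.agree (n - 2) (by omega) 0 (by omega)).2
  have h₂ := (h.agree (n - 2) (by omega) 1 (by omega)).1
  rw [foldLo_even_iff (by omega) (by omega)] at h₁
  rw [foldHi_odd_iff (by omega) (by omega)] at h₂
  refine ⟨h.agree.half hr (by omega) hc (by omega), by omega, by omega, ?_⟩
  have hne := h.ne
  rw [ne_eq, foldHi_even_iff hc (by omega)] at hne
  convert hne using 3 <;> omega

/-- An ambiguous window is determined by its bottom left symbol. -/
theorem Ambiguous.agree_of_corner {n r₁ c₁ r₁' c₁' r₂ c₂ r₂' c₂' : ℕ} (hn : 0 < n)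
    (h₁ : Ambiguous n r₁ c₁ r₁' c₁') (h₂ : Ambiguous n r₂ c₂ r₂' c₂')
    (hhi : foldHi (r₁ + (n - 1)) c₁ = foldHi (r₂ + (n - 1)) c₂)
    (hlo : foldLo (r₁ + (n - 1)) c₁ = foldLo (r₂ + (n - 1)) c₂) : Agree n r₁ c₁ r₂ c₂ := by
  induction n using Nat.strong_induction_on generalizing r₁ c₁ r₁' c₁' r₂ c₂ r₂' c₂' with
  | _ n ih =>
    obtain rfl | hn2 : n = 1 ∨ 2 ≤ n := by omega
    · intro a ha b hb
      obtain rfl : a = 0 := by omega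
      obtain rfl : b = 0 := by omega
      exact ⟨hhi, hlo⟩
    · obtain ⟨hr₁, hc₁⟩ := h₁.even hn
      obtain ⟨hr₂, hc₂⟩ := h₂.even hn
      obtain ⟨hr₁', hc₁'⟩ := (h₁.half hn2).even (by omega)
      obtain ⟨hr₂', hc₂'⟩ := (h₂.half hn2).even (by omega)
      rw [foldHi_even_iff hc₁ hc₂] at hhi
      rw [foldLo_odd_iff (by omega) (by omega)] at hlo
      refine Agree.of_half ?_ hr₁ (by omega) hc₁ (by omega)
      refine ih _ (by omega) (by omega) (h₁.half hn2) (h₂.half hn2) ?_ ?_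
      · convert hhi using 2 <;> omega
      · convert hlo using 2 <;> omega

theorem exists_ambiguous_one (s : Fin 4) (t : ℕ) (ht : t < 2) :
    ∃ r c, r % 2 = 1 ∧ (c + 1) % 2 = 0 ∧ foldSym r (c + 1) = s ∧ foldHi (r + 1) (c + 1) = t := by
  fin_cases s <;> interval_cases t
  · exact ⟨1, 3, rfl, rfl, by simp [foldSym, foldHi, foldLo]⟩
  · exact ⟨3, 1, rfl, rfl, by simp [foldSym, foldHi, foldLo]⟩
  · exact ⟨1, 1, rfl, rfl, by simp [foldSym, foldHi, foldLo]⟩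
  · exact ⟨11, 1, rfl, rfl, by simp [foldSym, foldHi, foldLo]⟩
  · exact ⟨7, 1, rfl, rfl, by simp [foldSym, foldHi, foldLo]⟩
  · exact ⟨5, 1, rfl, rfl, by simp [foldSym, foldHi, foldLo]⟩
  · exact ⟨3, 5, rfl, rfl, by simp [foldSym, foldHi, foldLo]⟩
  · exact ⟨1, 5, rfl, rfl, by simp [foldSym, foldHi, foldLo]⟩

/-- Every symbol is the bottom left symbol of an ambiguous window of each size. -/
theorem exists_ambiguous (s : Fin 4) {n : ℕ} (hn : 0 < n) :
    ∃ r c r' c', (r + n) % 2 = 0 ∧ (r' + n) % 2 = 0 ∧ (c + 1) % 2 = 0 ∧ (c' + 1) % 2 = 0 ∧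
      Agree n r (c + 1) r' (c' + 1) ∧ foldSym (r + (n - 1)) (c + 1) = s ∧
      foldHi (r + n) (c + 1) = 0 ∧ foldHi (r' + n) (c' + 1) = 1 := by
  induction n using Nat.strong_induction_on with
  | _ n ih =>
    obtain rfl | hn2 : n = 1 ∨ 2 ≤ n := by omega
    · obtain ⟨r, c, hr, hc, hs, hx⟩ := exists_ambiguous_one s 0 (by omega)
      obtain ⟨r', c', hr', hc', hs', hx'⟩ := exists_ambiguous_one s 1 (by omega)
      refine ⟨r, c, r', c', by omega, by omega, hc, hc', ?_, hs, hx, hx'⟩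
      intro a ha b hb
      obtain rfl : a = 0 := by omega
      obtain rfl : b = 0 := by omega
      exact foldSym_eq_iff.1 (hs.trans hs'.symm)
    · obtain ⟨r, c, r', c', hr, hr', hc, hc', h, hs, hx, hx'⟩ :=
        ih ((n + 1) / 2) (by omega) (by omega)
      refine ⟨2 * r + n % 2, 2 * c + 1, 2 * r' + n % 2, 2 * c' + 1, by omega, by omega, by omega,
        by omega, Agree.of_half ?_ (by omega) (by omega) (by omega) (by omega), ?_, ?_, ?_⟩
      · convert h using 1 <;> omega
      · rw [← hs, foldSym_eq_iff, foldHi_even _ (by omega), foldLo_odd _ (by omega)]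
        constructor <;> congr 1 <;> omega
      · rw [← hx, foldHi_even _ (by omega)]
        congr 1 <;> omega
      · rw [← hx', foldHi_even _ (by omega)]
        congr 1 <;> omega

/-! ### Counting -/

theorem ncard_range_eq_of_eq_iff {ι α β : Type*} {f : ι → α} {g : ι → β}
    (h : ∀ x y, f x = f y ↔ g x = g y) : (Set.range f).ncard = (Set.range g).ncard := by
  refine Set.ncard_congr (fun a ha => g ha.choose) (fun a _ => ⟨_, rfl⟩) ?_ ?_
  · intro a b ha hb hab
    rw [← ha.choose_spec, ← hb.choose_spec]
    exact (h _ _).2 hab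
  · rintro _ ⟨x, rfl⟩
    exact ⟨f x, ⟨x, rfl⟩, (h _ _).1 (Exists.choose_spec (⟨x, rfl⟩ : f x ∈ Set.range f))⟩

/-- The `n × n` patterns that occur with high bit `t` below their bottom left corner. -/
def patternsWith (n t : ℕ) : Set (Pat (Fin 4) n n) :=
  {p | ∃ x : ℕ × ℕ, window n n x.1 (x.2 + 1) = p ∧ foldHi (x.1 + n) (x.2 + 1) = t}

theorem patternsWith_union (n : ℕ) : patternsWith n 0 ∪ patternsWith n 1 = PS n n := by
  rw [PS_eq_range]
  ext p
  constructor
  · rintro (⟨x, hx, -⟩ | ⟨x, hx, -⟩) <;> exact ⟨x, hx⟩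
  · rintro ⟨x, hx⟩
    obtain h | h : foldHi (x.1 + n) (x.2 + 1) = 0 ∨ foldHi (x.1 + n) (x.2 + 1) = 1 := by
      have := foldHi_lt (x.1 + n) (x.2 + 1)
      omega
    · exact Or.inl ⟨x, hx, h⟩
    · exact Or.inr ⟨x, hx, h⟩

theorem ncard_patternsWith_inter {n : ℕ} (hn : 3 ≤ n) :
    (patternsWith n 0 ∩ patternsWith n 1).ncard = 4 := by
  let corner : Pat (Fin 4) n n → Fin 4 := fun p => p ⟨n - 1, by omega⟩ ⟨0, by omega⟩
  have himage : corner '' (patternsWith n 0 ∩ patternsWith n 1) = Set.univ := by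
    refine Set.eq_univ_of_forall fun s => ?_
    obtain ⟨r, c, r', c', -, -, -, -, h, hs, hx, hx'⟩ := exists_ambiguous s (n := n) (by omega)
    exact ⟨window n n r (c + 1),
      ⟨⟨(r, c), rfl, hx⟩, ⟨(r', c'), (window_eq_iff.2 h).symm, hx'⟩⟩, hs⟩
  have hinj : Set.InjOn corner (patternsWith n 0 ∩ patternsWith n 1) := by
    have amb : ∀ {r c r' c' : ℕ}, window n n r' c' = window n n r c → foldHi (r + n) c = 0 →
        foldHi (r' + n) c' = 1 → Ambiguous n r c r' c' := by
      intro r c r' c' h h₀ h₁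
      have h := window_eq_iff.1 h.symm
      exact ⟨h, h.row_parity hn, h.col_parity hn, by omega⟩
    rintro _ ⟨⟨x, rfl, hx⟩, x', hxx', hx'⟩ _ ⟨⟨y, rfl, hy⟩, y', hyy', hy'⟩ hxy
    have hsym := foldSym_eq_iff.1 hxy
    exact window_eq_iff.2
      ((amb hxx' hx hx').agree_of_corner (by omega) (amb hyy' hy hy') hsym.1 hsym.2)
  rw [← hinj.ncard_image, himage, Set.ncard_univ, Nat.card_eq_fintype_card,
    Fintype.card_fin]

theorem ncard_range_window_extended {n : ℕ} (hn : 3 ≤ n) :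
    (Set.range fun x : ℕ × ℕ =>
      (window n n x.1 (x.2 + 1), foldHi (x.1 + n) (x.2 + 1))).ncard = (PS n n).ncard + 4 := by
  have hsplit : (Set.range fun x : ℕ × ℕ =>
      (window n n x.1 (x.2 + 1), foldHi (x.1 + n) (x.2 + 1))) =
      (fun p => (p, 0)) '' patternsWith n 0 ∪ (fun p => (p, 1)) '' patternsWith n 1 := by
    ext ⟨p, t⟩
    constructor
    · rintro ⟨x, hx⟩
      obtain ⟨hp, ht⟩ := Prod.mk.inj hx
      have hlt := foldHi_lt (x.1 + n) (x.2 + 1)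
      obtain rfl | rfl : t = 0 ∨ t = 1 := by omega
      · exact Or.inl ⟨p, ⟨x, hp, ht⟩, rfl⟩
      · exact Or.inr ⟨p, ⟨x, hp, ht⟩, rfl⟩
    · rintro (⟨_, ⟨x, rfl, ht⟩, hx⟩ | ⟨_, ⟨x, rfl, ht⟩, hx⟩) <;>
        exact ⟨x, Prod.ext (Prod.mk.inj hx).1 (Eq.trans ht (Prod.mk.inj hx).2)⟩
  have hdisj : Disjoint ((fun p => (p, 0)) '' patternsWith n 0)
      ((fun p => (p, 1)) '' patternsWith n 1) := by
    rw [Set.disjoint_left]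
    rintro _ ⟨p, -, rfl⟩ ⟨q, -, hq⟩
    simp at hq
  rw [hsplit, Set.ncard_union_eq hdisj ((Set.toFinite _).image _) ((Set.toFinite _).image _),
    Set.ncard_image_of_injective _ (Prod.mk_left_injective 0),
    Set.ncard_image_of_injective _ (Prod.mk_left_injective 1),
    ← Set.ncard_union_add_ncard_inter, patternsWith_union, ncard_patternsWith_inter hn]

/-- The square patterns of side `2 * n` occurring in row parity class `i` and column parity class `j`. -/
def parityClass (n i j : ℕ) : Set (Pat (Fin 4) (2 * n) (2 * n)) :=
  Set.range fun x : ℕ × ℕ => window (2 * n) (2 * n) (2 * x.1 + i) (2 * (x.2 + 1) - j)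

theorem PS_two_mul_eq (n : ℕ) : PS (2 * n) (2 * n) =
    ((parityClass n 0 0 ∪ parityClass n 1 0) ∪ parityClass n 0 1) ∪ parityClass n 1 1 := by
  rw [PS_eq_range]
  ext p
  constructor
  · rintro ⟨⟨r, c⟩, rfl⟩
    have mem : window (2 * n) (2 * n) r (c + 1) ∈ parityClass n (r % 2) ((c + 1) % 2) := by
      refine ⟨(r / 2, (c + 1 + 1) / 2 - 1), ?_⟩
      dsimp only
      congr 1 <;> omega
    obtain hr | hr := Nat.mod_two_eq_zero_or_one r <;>
      obtain hc | hc := Nat.mod_two_eq_zero_or_one (c + 1) <;> rw [hr, hc] at mem <;>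
      simp only [Set.mem_union, mem, true_or, or_true]
  · rintro (((⟨x, rfl⟩ | ⟨x, rfl⟩) | ⟨x, rfl⟩) | ⟨x, rfl⟩)
    · exact ⟨(2 * x.1, 2 * x.2 + 1), rfl⟩
    · exact ⟨(2 * x.1 + 1, 2 * x.2 + 1), rfl⟩
    · exact ⟨(2 * x.1, 2 * x.2), rfl⟩
    · exact ⟨(2 * x.1 + 1, 2 * x.2), rfl⟩

theorem disjoint_parityClass {n i j i' j' : ℕ} (hn : 3 ≤ n) (hi : i < 2) (hj : j < 2)
    (hi' : i' < 2) (hj' : j' < 2) (h : i ≠ i' ∨ j ≠ j') :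
    Disjoint (parityClass n i j) (parityClass n i' j') := by
  rw [Set.disjoint_left]
  rintro _ ⟨x, rfl⟩ ⟨y, hy⟩
  have hag := window_eq_iff.1 hy
  have := hag.row_parity (by omega)
  have := hag.col_parity (by omega)
  omega

theorem ncard_parityClass_zero {n : ℕ} (hn : 3 ≤ n) :
    (parityClass n 0 0).ncard = (PS n n).ncard := by
  rw [PS_eq_range]
  refine ncard_range_eq_of_eq_iff fun x y => ?_
  rw [window_eq_iff, window_eq_iff]
  exact ⟨Agree.of_double (by omega) (by omega),
    fun h => h.double hn (by omega) (by omega) (by omega)⟩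

theorem ncard_parityClass {n i j : ℕ} (hn : 3 ≤ n) (hi : i < 2) (hj : j < 2)
    (hij : i = 1 ∨ j = 1) : (parityClass n i j).ncard = (PS n n).ncard + 4 := by
  rw [← ncard_range_window_extended hn]
  refine ncard_range_eq_of_eq_iff fun x y => ?_
  rw [Prod.mk.injEq, window_eq_iff, window_eq_iff]
  exact ⟨fun h => ⟨h.of_double hi hj, h.corner_of_double (by omega) hi hj hij⟩,
    fun h => h.1.double hn hi hj fun _ => h.2⟩

/-- Lemma 5.3: for n ≥ 3, A_{2n} = 4·A_n + 12. -/
theorem A_even_recursion (n : ℕ) (hn : 3 ≤ n) :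
    Acnt (2 * n) = 4 * Acnt n + 12 := by
  have d : ∀ {i j i' j' : ℕ}, i < 2 → j < 2 → i' < 2 → j' < 2 → i ≠ i' ∨ j ≠ j' →
      Disjoint (parityClass n i j) (parityClass n i' j') :=
    disjoint_parityClass hn
  rw [Acnt, Acnt, Nat.card_coe_set_eq, Nat.card_coe_set_eq, PS_two_mul_eq, Set.ncard_union_eq,
    Set.ncard_union_eq, Set.ncard_union_eq, ncard_parityClass_zero hn,
    ncard_parityClass hn (by omega) (by omega) (by omega),
    ncard_parityClass hn (by omega) (by omega) (by omega),
    ncard_parityClass hn (by omega) (by omega) (by omega)]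
  · ring
  · exact d (by omega) (by omega) (by omega) (by omega) (by omega)
  · exact Set.disjoint_union_left.2 ⟨d (by omega) (by omega) (by omega) (by omega) (by omega),
      d (by omega) (by omega) (by omega) (by omega) (by omega)⟩
  · exact Set.disjoint_union_left.2
      ⟨Set.disjoint_union_left.2 ⟨d (by omega) (by omega) (by omega) (by omega) (by omega),
        d (by omega) (by omega) (by omega) (by omega) (by omega)⟩,
        d (by omega) (by omega) (by omega) (by omega) (by omega)⟩
end

section
/- For every integer n ≥ 3, A_{2n+1} = 2·A_n + 2·A_{n+1}. -/
namespace Paperfold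

/-! ### The four binary digits of a letter -/

/-- The digit of a letter that `phi` reads along even columns. -/
def colBit : A16 → Bool
  | .A | .B | .C | .D | .E | .F | .G | .H => false
  | _ => true

/-- The digit of a letter that records the parity of row plus column. -/
def diagBit : A16 → Bool
  | .A | .B | .C | .D | .I | .J | .K | .L => false
  | _ => true

/-- The digit of a letter that records the parity of the row. -/
def parBit : A16 → Bool
  | .A | .B | .E | .F | .I | .J | .M | .N => false
  | _ => true

/-- The digit of a letter that `phi` reads along odd rows. -/
def rowBit : A16 → Bool
  | .A | .C | .E | .G | .I | .K | .M | .O => false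
  | _ => true

/-- The symbol with the given two binary digits. -/
def symb (a b : Bool) : Fin 4 :=
  match a, b with
  | false, false => 0
  | false, true => 1
  | true, false => 2
  | true, true => 3

lemma symb_inj {a b a' b' : Bool} : symb a b = symb a' b' ↔ a = a' ∧ b = b' := by
  revert a b a' b'; decide

lemma phiE_eq (x : A16) (r c : ℕ) :
    phiE x r c = symb (colBit (muE x r c)) (rowBit (muE x r c)) := by
  rcases Nat.mod_two_eq_zero_or_one r with hr | hr <;>
    rcases Nat.mod_two_eq_zero_or_one c with hc | hc <;>
    simp only [phiE, muE, hr, hc] <;> cases x <;> rfl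

lemma colBit_muE (x : A16) (r c : ℕ) :
    colBit (muE x r c) = if c % 2 = 1 then diagBit x else colBit x := by
  rcases Nat.mod_two_eq_zero_or_one r with hr | hr <;>
    rcases Nat.mod_two_eq_zero_or_one c with hc | hc <;>
    simp only [muE, hr, hc] <;> cases x <;> rfl

lemma diagBit_muE (x : A16) (r c : ℕ) :
    diagBit (muE x r c) = decide ((r + c) % 2 = 1) := by
  rw [Nat.add_mod]
  rcases Nat.mod_two_eq_zero_or_one r with hr | hr <;>
    rcases Nat.mod_two_eq_zero_or_one c with hc | hc <;>
    simp only [muE, hr, hc] <;> cases x <;> rfl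

lemma parBit_muE (x : A16) (r c : ℕ) : parBit (muE x r c) = decide (r % 2 = 1) := by
  rcases Nat.mod_two_eq_zero_or_one r with hr | hr <;>
    rcases Nat.mod_two_eq_zero_or_one c with hc | hc <;>
    simp only [muE, hr, hc] <;> cases x <;> rfl

lemma rowBit_muE (x : A16) (r c : ℕ) :
    rowBit (muE x r c) =
      if r % 2 = 1 then rowBit x else xor (parBit x) (decide (c % 2 = 1)) := by
  rcases Nat.mod_two_eq_zero_or_one r with hr | hr <;>
    rcases Nat.mod_two_eq_zero_or_one c with hc | hc <;>
    simp only [muE, hr, hc] <;> cases x <;> rfl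

lemma muE_congr (x : A16) {r c r' c' : ℕ} (hr : r % 2 = r' % 2) (hc : c % 2 = c' % 2) :
    muE x r c = muE x r' c' := by
  simp only [muE, hr, hc]

/-! ### The two binary planes of the limit array -/

/-- Fuelled form of `U`. -/
def uAux : ℕ → ℕ → ℕ → Bool
  | 0, _, _ => false
  | k + 1, r, c => if c % 2 = 1 then decide ((r / 2 + c / 2) % 2 = 1) else uAux k (r / 2) (c / 2)

/-- Fuelled form of `V`. -/
def vAux : ℕ → ℕ → ℕ → Bool
  | 0, _, _ => false
  | k + 1, r, c => if r % 2 = 0 then decide ((r / 2 + c) % 2 = 1) else vAux k (r / 2) (c / 2)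

/-- The first binary plane of the limit of the supertiles of `A`. -/
def U (r c : ℕ) : Bool := uAux c r c

/-- The second binary plane of the limit of the supertiles of `A`. -/
def V (r c : ℕ) : Bool := vAux (r + 1) r c

lemma uAux_congr {k l r c : ℕ} (hk : c ≤ k) (hl : c ≤ l) : uAux k r c = uAux l r c := by
  induction k generalizing l r c with
  | zero =>
    obtain rfl : c = 0 := by omega
    clear hk hl
    induction l generalizing r with
    | zero => rfl
    | succ l ih => simpa [uAux] using ih
  | succ k ih =>
    cases l with
    | zero =>
      obtain rfl : c = 0 := by omega
      have := @ih 0 (r / 2) 0 (by omega) (by omega)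
      simpa [uAux] using this
    | succ l =>
      simp only [uAux]
      rw [@ih l (r / 2) (c / 2) (by omega) (by omega)]

lemma vAux_congr {k l r c : ℕ} (hk : r < k) (hl : r < l) : vAux k r c = vAux l r c := by
  induction k generalizing l r c with
  | zero => omega
  | succ k ih =>
    cases l with
    | zero => omega
    | succ l =>
      simp only [vAux]
      split_ifs with h
      · rfl
      · exact ih (by omega) (by omega)

lemma U_eq (r c : ℕ) :
    U r c = if c % 2 = 1 then decide ((r / 2 + c / 2) % 2 = 1) else U (r / 2) (c / 2) := by
  unfold U
  rw [uAux_congr (l := c + 1) le_rfl (by omega), uAux,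
    uAux_congr (k := c) (l := c / 2) (by omega) le_rfl]

lemma V_eq (r c : ℕ) :
    V r c = if r % 2 = 0 then decide ((r / 2 + c) % 2 = 1) else V (r / 2) (c / 2) := by
  unfold V
  rw [vAux]
  split_ifs with h
  · rfl
  · exact vAux_congr (by omega) (by omega)

lemma bits_superE (k r c : ℕ) (hr : r < 2 ^ k) (hc : c < 2 ^ k) :
    colBit (superE k .A r c) = U r c ∧ rowBit (superE k .A r c) = V r c ∧
    diagBit (superE k .A r c) = decide ((r + c) % 2 = 1) ∧
    parBit (superE k .A r c) = decide (r % 2 = 1) := by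
  induction k generalizing r c with
  | zero =>
    obtain rfl : r = 0 := by simpa using hr
    obtain rfl : c = 0 := by simpa using hc
    decide
  | succ k ih =>
    have hk : 2 ^ (k + 1) = 2 * 2 ^ k := by ring
    obtain ⟨h1, h2, h3, h4⟩ := ih (r / 2) (c / 2) (by omega) (by omega)
    simp only [superE]
    rw [colBit_muE, rowBit_muE, diagBit_muE, parBit_muE, h1, h2, h3, h4, U_eq r c, V_eq r c]
    refine ⟨rfl, ?_, rfl, rfl⟩
    rcases Nat.mod_two_eq_zero_or_one r with h | h
    · rw [if_neg (by omega), if_pos h, Nat.add_mod (r / 2) c]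
      rcases Nat.mod_two_eq_zero_or_one (r / 2) with h' | h' <;>
        rcases Nat.mod_two_eq_zero_or_one c with h'' | h'' <;> simp [h', h'']
    · rw [if_pos h, if_neg (by omega)]

lemma superE_superE (k j : ℕ) (x : A16) (a b r c : ℕ) (hr : r < 2 ^ k) (hc : c < 2 ^ k) :
    superE k (superE j x a b) r c = superE (k + j) x (a * 2 ^ k + r) (b * 2 ^ k + c) := by
  induction k generalizing r c with
  | zero =>
    obtain rfl : r = 0 := by simpa using hr
    obtain rfl : c = 0 := by simpa using hc
    simp [superE]
  | succ k ih =>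
    have hk : 2 ^ (k + 1) = 2 * 2 ^ k := by ring
    have e (a r : ℕ) : a * 2 ^ (k + 1) + r = 2 * (a * 2 ^ k) + r := by rw [hk]; ring
    rw [show k + 1 + j = (k + j) + 1 by omega]
    simp only [superE]
    rw [ih _ _ (by omega) (by omega), e, e]
    rw [show (2 * (a * 2 ^ k) + r) / 2 = a * 2 ^ k + r / 2 by omega,
      show (2 * (b * 2 ^ k) + c) / 2 = b * 2 ^ k + c / 2 by omega]
    exact muE_congr _ (by omega) (by omega)

/-- The pattern of the limit array at a given position. -/
def patS (m n : ℕ) (p : ℕ × ℕ) : Pat (Fin 4) m n :=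
  fun i j => symb (U (p.1 + i) (p.2 + j)) (V (p.1 + i) (p.2 + j))

lemma Sfun_eq (k r c : ℕ) :
    Sfun k r c = symb (colBit (superE (k + 1) .N r c)) (rowBit (superE (k + 1) .N r c)) :=
  phiE_eq _ _ _

lemma PS_eq_range (m n : ℕ) : PS m n = Set.range (patS m n) := by
  ext q
  simp only [PS, patIn, Set.mem_iUnion, Set.mem_ofPred_eq, Set.mem_range]
  constructor
  · rintro ⟨k, r, c, hr, hc, h⟩
    refine ⟨(r, 3 * 2 ^ (k + 1) + c), ?_⟩
    funext i j
    have hi : r + i < 2 ^ (k + 1) := by omega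
    have hj : c + j < 2 ^ (k + 1) := by omega
    have hN : superE 2 .A 0 3 = .N := by decide
    have h3 := superE_superE (k + 1) 2 .A 0 3 (r + i) (c + j) hi hj
    have hp : 2 ^ (k + 1 + 2) = 4 * 2 ^ (k + 1) := by ring
    obtain ⟨h1, h2, -, -⟩ := bits_superE (k + 1 + 2) (r + i) (3 * 2 ^ (k + 1) + (c + j))
      (by omega) (by omega)
    rw [hN, zero_mul, zero_add] at h3
    rw [h, Sfun_eq, h3, h1, h2]
    simp only [patS, add_assoc]
  · rintro ⟨⟨r, c⟩, rfl⟩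
    have hk : r + c + m + n < 2 ^ (r + c + m + n) := Nat.lt_two_pow_self
    obtain ⟨k, hk1, hk2⟩ : ∃ k, r + m ≤ 2 ^ k ∧ c + n ≤ 2 ^ k :=
      ⟨r + c + m + n, by omega, by omega⟩
    have hp : 2 ^ (k + 2 + 1) = 8 * 2 ^ k := by ring
    refine ⟨k + 2, r, 2 * 2 ^ k + c, by omega, by omega, fun i j => ?_⟩
    have hi : r + i < 2 ^ k := by omega
    have hj : c + j < 2 ^ k := by omega
    have hA : superE 3 .N 0 2 = .A := by decide
    have h3 := superE_superE k 3 .N 0 2 (r + i) (c + j) hi hj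
    obtain ⟨h1, h2, -, -⟩ := bits_superE k (r + i) (c + j) hi hj
    rw [hA, zero_mul, zero_add] at h3
    rw [Sfun_eq, add_assoc (2 * 2 ^ k), show k + 2 + 1 = k + 3 from rfl, ← h3, h1, h2]
    rfl

/-! ### Counting windows -/

/-- Two positions have the same parities, the same `U`-window of size `m × n` without its first `e`
columns, and the same `V`-window of size `m × n` without its last `f` rows. -/
def SameWindow (m n e f : ℕ) (p q : ℕ × ℕ) : Prop :=
  (p.1 % 2 = q.1 % 2 ∧ p.2 % 2 = q.2 % 2) ∧
  (∀ x < m, ∀ y < n, e ≤ y → U (p.1 + x) (p.2 + y) = U (q.1 + x) (q.2 + y)) ∧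
  (∀ x < m - f, ∀ y < n, V (p.1 + x) (p.2 + y) = V (q.1 + x) (q.2 + y))

lemma SameWindow.mono {m n e f m' n' e' f' : ℕ} {p q : ℕ × ℕ} (h : SameWindow m n e f p q)
    (hm : m' ≤ m) (hn : n' ≤ n) (he : e ≤ e') (hf : m' - f' ≤ m - f) :
    SameWindow m' n' e' f' p q :=
  ⟨h.1, fun x hx y hy hy' => h.2.1 x (by omega) y (by omega) (by omega),
    fun x hx y hy => h.2.2 x (by omega) y (by omega)⟩

/-- The position in the `(i, j)` corner of the image of a position under the substitution. -/
def corner (i j : ℕ) (p : ℕ × ℕ) : ℕ × ℕ := (2 * p.1 + i, 2 * p.2 + j)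

lemma sameWindow_corner {m n e f m' i j : ℕ} {p q : ℕ × ℕ} (hm' : m' = (m + i + 1) / 2)
    (h : SameWindow m' ((n + j + 1) / 2) ((e + j + 1) / 2) (m' - (m - f + i) / 2) p q) :
    SameWindow m n e f (corner i j p) (corner i j q) := by
  obtain ⟨⟨h1, h2⟩, hU, hV⟩ := h
  refine ⟨by simp only [corner]; omega, fun x hx y hy hy' => ?_, fun x hx y hy => ?_⟩
  · simp only [corner]
    rw [U_eq, U_eq (2 * q.1 + i + x)]
    have e1 (a : ℕ) : (2 * a + i + x) / 2 = a + (i + x) / 2 := by omega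
    have e2 (a : ℕ) : (2 * a + j + y) / 2 = a + (j + y) / 2 := by omega
    have e3 (a : ℕ) : (2 * a + j + y) % 2 = (j + y) % 2 := by omega
    rw [e1, e1, e2, e2, e3, e3]
    split_ifs with hc
    · congr 1
      rw [eq_iff_iff]
      omega
    · exact hU _ (by omega) _ (by omega) (by omega)
  · simp only [corner]
    rw [V_eq, V_eq (2 * q.1 + i + x)]
    have e1 (a : ℕ) : (2 * a + i + x) / 2 = a + (i + x) / 2 := by omega
    have e2 (a : ℕ) : (2 * a + j + y) / 2 = a + (j + y) / 2 := by omega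
    have e3 (a : ℕ) : (2 * a + i + x) % 2 = (i + x) % 2 := by omega
    rw [e1, e1, e2, e2, e3, e3]
    split_ifs with hc
    · congr 1
      rw [eq_iff_iff]
      omega
    · exact hV _ (by omega) _ (by omega)

lemma SameWindow.of_corner {m n e f m' i j : ℕ} {p q : ℕ × ℕ} (hm' : m' = (m + i + 1) / 2)
    (he : e + 2 ≤ n) (hf : f + 2 ≤ m)
    (hi : i < 2) (hj : j < 2) (h : SameWindow m n e f (corner i j p) (corner i j q)) :
    SameWindow m' ((n + j + 1) / 2) ((e + j + 1) / 2) (m' - (m - f + i) / 2) p q := by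
  obtain ⟨-, hU, hV⟩ := h
  simp only [corner] at hU hV
  have hdiag : (p.1 + p.2) % 2 = (q.1 + q.2) % 2 := by
    obtain ⟨y, hy1, hy2, hy3⟩ : ∃ y, e ≤ y ∧ y < n ∧ (j + y) % 2 = 1 := by
      rcases Nat.mod_two_eq_zero_or_one (j + e) with h | h
      · exact ⟨e + 1, by omega, by omega, by omega⟩
      · exact ⟨e, by omega, by omega, by omega⟩
    have := hU 0 (by omega) y hy2 hy1
    rw [U_eq, U_eq (_ + _), if_pos (by omega), if_pos (by omega), decide_eq_decide] at this
    omega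
  have hrow : p.1 % 2 = q.1 % 2 := by
    obtain ⟨x, hx1, hx2⟩ : ∃ x, x < 2 ∧ (i + x) % 2 = 0 := ⟨i, hi, by omega⟩
    have := hV x (by omega) 0 (by omega)
    rw [V_eq, V_eq (_ + _), if_pos (by omega), if_pos (by omega), decide_eq_decide] at this
    omega
  refine ⟨⟨hrow, by omega⟩, fun x hx y hy hy' => ?_, fun x hx y hy => ?_⟩
  · obtain ⟨x', hx', rfl⟩ : ∃ x', x' < m ∧ x = (i + x') / 2 := ⟨2 * x - i, by omega, by omega⟩
    have := hU x' hx' (2 * y - j) (by omega) (by omega)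
    rw [U_eq, U_eq (_ + _), if_neg (by omega), if_neg (by omega)] at this
    convert this using 2 <;> omega
  · obtain ⟨y', hy', rfl⟩ : ∃ y', y' < n ∧ y = (j + y') / 2 := ⟨2 * y - j, by omega, by omega⟩
    have := hV (2 * x + 1 - i) (by omega) y' hy'
    rw [V_eq, V_eq (_ + _), if_neg (by omega), if_neg (by omega)] at this
    convert this using 2 <;> omega

/-- An injective encoding of lists of bits. -/
def bitsCode : List Bool → ℕ
  | [] => 1
  | b :: l => 2 * bitsCode l + b.toNat

lemma bitsCode_pos (l : List Bool) : 0 < bitsCode l := by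
  induction l with
  | nil => exact one_pos
  | cons b l ih => simp only [bitsCode]; omega

lemma bitsCode_lt (l : List Bool) : bitsCode l < 2 ^ (l.length + 1) := by
  induction l with
  | nil => decide
  | cons b l ih =>
    have := b.toNat_le
    simp only [bitsCode, List.length_cons, pow_succ] at ih ⊢
    omega

lemma bitsCode_injective : Function.Injective bitsCode := by
  intro l
  induction l with
  | nil =>
    rintro (_ | ⟨b, l⟩) h
    · rfl
    · have := bitsCode_pos l
      simp only [bitsCode] at h
      omega
  | cons b l ih =>
    rintro (_ | ⟨b', l'⟩) h
    · have := bitsCode_pos l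
      simp only [bitsCode] at h
      omega
    · simp only [bitsCode] at h
      have hb := b.toNat_le
      have hb' := b'.toNat_le
      rw [ih (show bitsCode l = bitsCode l' by omega),
        show b = b' by
          have : b.toNat = b'.toNat := by omega
          cases b <;> cases b' <;> simp_all]

/-- The entries compared by `SameWindow`. -/
def window (m n e f : ℕ) (p : ℕ × ℕ) : List Bool :=
  (((List.range m ×ˢ List.range n).filter fun z => e ≤ z.2).map
      fun z => U (p.1 + z.1) (p.2 + z.2)) ++
    (List.range (m - f) ×ˢ List.range n).map fun z => V (p.1 + z.1) (p.2 + z.2)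

lemma window_eq_iff {m n e f : ℕ} {p q : ℕ × ℕ} :
    window m n e f p = window m n e f q ↔
      (∀ x < m, ∀ y < n, e ≤ y → U (p.1 + x) (p.2 + y) = U (q.1 + x) (q.2 + y)) ∧
      (∀ x < m - f, ∀ y < n, V (p.1 + x) (p.2 + y) = V (q.1 + x) (q.2 + y)) := by
  have split {a b c d : List Bool} (h : a.length = c.length) :
      a ++ b = c ++ d ↔ a = c ∧ b = d :=
    ⟨fun h' => List.append_inj h' h, fun h' => by rw [h'.1, h'.2]⟩
  rw [window, window, split (by simp only [List.length_map])]
  simp only [List.map_inj_left, List.mem_filter,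
    List.mem_product, List.mem_range, Prod.forall, decide_eq_true_eq]
  constructor
  · rintro ⟨h2, h3⟩
    exact ⟨fun x hx y hy he => h2 x y ⟨⟨hx, hy⟩, he⟩, fun x hx y hy => h3 x y ⟨hx, hy⟩⟩
  · rintro ⟨h2, h3⟩
    exact ⟨fun x y h => h2 x h.1.1 y h.1.2 h.2, fun x y h => h3 x h.1 y h.2⟩

/-- An encoding of the data compared by `SameWindow`. -/
def key (m n e f : ℕ) (p : ℕ × ℕ) : ℕ :=
  4 * bitsCode (window m n e f p) + (2 * (p.1 % 2) + p.2 % 2)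

lemma key_eq_iff {m n e f : ℕ} {p q : ℕ × ℕ} :
    key m n e f p = key m n e f q ↔ SameWindow m n e f p q := by
  rw [SameWindow, ← window_eq_iff, ← bitsCode_injective.eq_iff]
  simp only [key]
  omega

/-- The number of windows of a given shape. -/
noncomputable def cnt (m n e f : ℕ) : ℕ := Nat.card (Set.range (key m n e f))

lemma finite_range_key (m n e f : ℕ) : (Set.range (key m n e f)).Finite := by
  refine (Set.finite_Iio (4 * 2 ^ ((window m n e f (0, 0)).length + 1))).subset ?_
  rintro _ ⟨p, rfl⟩
  have h := bitsCode_lt (window m n e f p)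
  rw [show (window m n e f p).length = (window m n e f (0, 0)).length by
    simp only [window, List.length_append, List.length_map]] at h
  simp only [key, Set.mem_Iio]
  omega

lemma card_range_congr {α β γ : Type*} {f : α → β} {g : α → γ}
    (h : ∀ p q, f p = f q ↔ g p = g q) : Nat.card (Set.range f) = Nat.card (Set.range g) := by
  refine Nat.card_congr ((Setoid.quotientKerEquivRange f).symm.trans
    ((Quotient.congr (Equiv.refl α) fun p q => ?_).trans (Setoid.quotientKerEquivRange g)))
  exact h p q

lemma corner_half (p : ℕ × ℕ) : corner (p.1 % 2) (p.2 % 2) (p.1 / 2, p.2 / 2) = p := by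
  ext <;> simp only [corner] <;> omega

lemma cnt_rec {m n e f : ℕ} (he : e + 2 ≤ n) (hf : f + 2 ≤ m) :
    cnt m n e f =
      ∑ i : Fin 2, ∑ j : Fin 2, cnt ((m + i + 1) / 2) ((n + j + 1) / 2) ((e + j + 1) / 2)
        ((m + i + 1) / 2 - (m - f + i) / 2) := by
  let t (z : Fin 2 × Fin 2) := Set.range (key m n e f ∘ corner z.1 z.2)
  have hunion : Set.range (key m n e f) = ⋃ z, t z := by
    ext k
    simp only [t, Set.mem_iUnion, Set.mem_range, Function.comp_apply]
    constructor
    · rintro ⟨p, rfl⟩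
      exact ⟨(⟨p.1 % 2, Nat.mod_lt _ two_pos⟩, ⟨p.2 % 2, Nat.mod_lt _ two_pos⟩), (p.1 / 2, p.2 / 2),
        congrArg _ (corner_half p)⟩
    · rintro ⟨z, p, rfl⟩
      exact ⟨_, rfl⟩
  have hdisj : Pairwise (Function.onFun Disjoint t) := by
    intro z w hzw
    refine Set.disjoint_left.2 ?_
    rintro _ ⟨p, rfl⟩ ⟨q, hq⟩
    obtain ⟨h1, h2⟩ := (key_eq_iff.1 hq).1
    simp only [corner] at h1 h2
    exact hzw (Prod.ext (by omega) (by omega))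
  have hfin (z : Fin 2 × Fin 2) : Finite (t z) :=
    ((finite_range_key m n e f).subset (Set.range_comp_subset_range _ _)).to_subtype
  rw [← Fintype.sum_prod_type']
  unfold cnt
  rw [hunion, Nat.card_congr (Set.unionEqSigmaOfDisjoint hdisj), Nat.card_sigma]
  refine Finset.sum_congr rfl fun z _ => card_range_congr fun p q => ?_
  simp only [Function.comp_apply, key_eq_iff]
  exact ⟨fun h => SameWindow.of_corner rfl he hf z.1.2 z.2.2 h, sameWindow_corner rfl⟩

section Recursion

variable {k l e f : ℕ}

lemma cnt_even_even (hk : 2 ≤ k) (hl : 2 ≤ l) (he : e ≤ 1) (hf : f ≤ 1) :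
    cnt (2 * k) (2 * l) e f =
      cnt k l e f + cnt k (l + 1) 1 f + cnt (k + 1) l e 1 + cnt (k + 1) (l + 1) 1 1 := by
  rw [cnt_rec (by omega) (by omega)]
  simp only [Fin.sum_univ_two, Fin.val_zero, Fin.val_one, ← add_assoc]
  congr <;> omega

lemma cnt_even_odd (hk : 2 ≤ k) (hl : 1 ≤ l) (he : e ≤ 1) (hf : f ≤ 1) :
    cnt (2 * k) (2 * l + 1) e f =
      cnt k (l + 1) e f + cnt k (l + 1) 1 f + cnt (k + 1) (l + 1) e 1 +
        cnt (k + 1) (l + 1) 1 1 := by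
  rw [cnt_rec (by omega) (by omega)]
  simp only [Fin.sum_univ_two, Fin.val_zero, Fin.val_one, ← add_assoc]
  congr <;> omega

lemma cnt_odd_even (hk : 1 ≤ k) (hl : 2 ≤ l) (he : e ≤ 1) (hf : f ≤ 1) :
    cnt (2 * k + 1) (2 * l) e f =
      cnt (k + 1) l e 1 + cnt (k + 1) (l + 1) 1 1 + cnt (k + 1) l e f +
        cnt (k + 1) (l + 1) 1 f := by
  rw [cnt_rec (by omega) (by omega)]
  simp only [Fin.sum_univ_two, Fin.val_zero, Fin.val_one, ← add_assoc]
  congr <;> omega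

lemma cnt_odd_odd (hk : 1 ≤ k) (hl : 1 ≤ l) (he : e ≤ 1) (hf : f ≤ 1) :
    cnt (2 * k + 1) (2 * l + 1) e f =
      cnt (k + 1) (l + 1) e 1 + cnt (k + 1) (l + 1) 1 1 + cnt (k + 1) (l + 1) e f +
        cnt (k + 1) (l + 1) 1 f := by
  rw [cnt_rec (by omega) (by omega)]
  simp only [Fin.sum_univ_two, Fin.val_zero, Fin.val_one, ← add_assoc]
  congr <;> omega

end Recursion

/-- Call-by-value application, for evaluation in the kernel. -/
def callWith {α : Type*} (n : ℕ) (k : ℕ → α) : α := Nat.rec (k 0) (fun m _ => k (m + 1)) n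

lemma callWith_eq {α : Type*} (n : ℕ) (k : ℕ → α) : callWith n k = k n := by
  cases n <;> rfl

/-- The number of distinct entries of a list outside the set of one bits of `s`. -/
def countNew : List ℕ → ℕ → ℕ
  | [], _ => 0
  | a :: l, s =>
    callWith a fun a => bif s.testBit a then countNew l s else
      callWith (s ||| 2 ^ a) fun t => countNew l t + 1

lemma countNew_eq (l : List ℕ) (s : ℕ) :
    countNew l s = (l.toFinset.filter fun a => s.testBit a = false).card := by
  induction l generalizing s with
  | nil => rfl
  | cons a l ih =>
    rw [countNew, callWith_eq, List.toFinset_cons, Finset.filter_insert]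
    cases h : s.testBit a
    · rw [cond_false, callWith_eq, ih, if_pos rfl, ← Finset.card_insert_of_notMem
        (a := a) (by simp [Nat.testBit_two_pow])]
      congr 1
      ext x
      by_cases hx : x = a
      · simp [hx]
      · simp [hx, Nat.testBit_two_pow, Ne.symm hx]
    · simp [ih]

lemma countNew_zero (l : List ℕ) : countNew l 0 = l.toFinset.card := by
  simp [countNew_eq]

/-- Positions representing all `2 × 2` windows. -/
def reps : List (ℕ × ℕ) :=
  [(0, 0), (0, 1), (0, 2), (0, 3), (0, 5), (0, 6), (0, 11), (0, 12), (1, 0), (1, 1), (1, 2),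
   (1, 3), (1, 5), (1, 6), (1, 11), (1, 12), (2, 0), (2, 1), (2, 2), (2, 3), (2, 4), (2, 5),
   (2, 6), (2, 7), (2, 11), (2, 12), (3, 0), (3, 1), (3, 2), (3, 3), (3, 4), (3, 5), (3, 6),
   (3, 7), (3, 11), (3, 12), (4, 0), (4, 1), (4, 2), (4, 3), (4, 5), (4, 6), (4, 11), (4, 12),
   (5, 0), (5, 1), (5, 2), (5, 3), (5, 5), (5, 6), (5, 11), (5, 12), (6, 1), (6, 2), (6, 3),
   (6, 11), (7, 1), (7, 2), (7, 3), (7, 4), (7, 11), (7, 12), (10, 1), (10, 2), (10, 3), (10,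
   4), (11, 1), (11, 2), (11, 3), (11, 4), (14, 3), (15, 3), (15, 4), (22, 3), (23, 3), (23, 4)]

/-- Positions representing all windows of size at most `3 × 3`. -/
def subReps : List (ℕ × ℕ) :=
  reps.flatMap fun q => [corner 0 0 q, corner 0 1 q, corner 1 0 q, corner 1 1 q]

lemma mem_subReps {i j : ℕ} {q : ℕ × ℕ} (hi : i < 2) (hj : j < 2) (hq : q ∈ reps) :
    corner i j q ∈ subReps := by
  refine List.mem_flatMap.2 ⟨q, hq, ?_⟩
  interval_cases i <;> interval_cases j <;> simp

lemma subReps_closed {q : ℕ × ℕ} (hq : q ∈ subReps) :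
    ∃ q' ∈ reps, key 2 2 0 0 q = key 2 2 0 0 q' := by
  have hcard : countNew ((reps ++ subReps).map (key 2 2 0 0)) 0 ≤
      countNew (reps.map (key 2 2 0 0)) 0 := by
    decide +kernel
  rw [countNew_zero, countNew_zero] at hcard
  have hsub : (reps.map (key 2 2 0 0)).toFinset ⊆
      ((reps ++ subReps).map (key 2 2 0 0)).toFinset := by
    rw [List.map_append, List.toFinset_append]
    exact Finset.subset_union_left
  have hmem : key 2 2 0 0 q ∈ (reps.map (key 2 2 0 0)).toFinset := by
    rw [Finset.eq_of_subset_of_card_le hsub hcard, List.mem_toFinset]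
    exact List.mem_map_of_mem (List.mem_append_right _ hq)
  simpa only [List.mem_toFinset, List.mem_map, eq_comm] using hmem

lemma exists_subReps_of_reps {m n e f : ℕ} (hm : m ≤ 3) (hn : n ≤ 3) {p q : ℕ × ℕ}
    (hq : q ∈ reps) (h : SameWindow 2 2 0 0 (p.1 / 2, p.2 / 2) q) :
    ∃ q' ∈ subReps, key m n e f p = key m n e f q' := by
  refine ⟨_, mem_subReps (Nat.mod_lt p.1 two_pos) (Nat.mod_lt p.2 two_pos) hq, ?_⟩
  rw [key_eq_iff]
  nth_rw 1 [← corner_half p]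
  exact sameWindow_corner rfl (h.mono (by omega) (by omega) (by omega) (by omega))

lemma exists_reps (p : ℕ × ℕ) : ∃ q ∈ reps, key 2 2 0 0 p = key 2 2 0 0 q := by
  obtain ⟨s, hs⟩ : ∃ s, p.1 + p.2 = s := ⟨_, rfl⟩
  induction s using Nat.strong_induction_on generalizing p with
  | _ s ih =>
    rcases Nat.eq_zero_or_pos s with rfl | hpos
    · obtain ⟨p1, p2⟩ := p
      obtain ⟨rfl, rfl⟩ : p1 = 0 ∧ p2 = 0 := by simpa using hs
      exact ⟨(0, 0), by decide, rfl⟩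
    · obtain ⟨q, hq, h⟩ := ih (p.1 / 2 + p.2 / 2) (by omega) (p.1 / 2, p.2 / 2) rfl
      obtain ⟨q', hq', h'⟩ := exists_subReps_of_reps (m := 2) (n := 2) (e := 0) (f := 0)
        (by norm_num) (by norm_num) hq (key_eq_iff.1 h)
      obtain ⟨q'', hq'', h''⟩ := subReps_closed hq'
      exact ⟨q'', hq'', h'.trans h''⟩

lemma range_key_eq {m n : ℕ} (e f : ℕ) (hm : m ≤ 3) (hn : n ≤ 3) :
    Set.range (key m n e f) = ((subReps.map (key m n e f)).toFinset : Set _) := by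
  ext k
  simp only [Set.mem_range, List.coe_toFinset, List.mem_map, Set.mem_ofPred_eq]
  constructor
  · rintro ⟨p, rfl⟩
    obtain ⟨q, hq, h⟩ := exists_reps (p.1 / 2, p.2 / 2)
    obtain ⟨q', hq', h'⟩ := exists_subReps_of_reps hm hn (e := e) (f := f) hq (key_eq_iff.1 h)
    exact ⟨q', hq', h'.symm⟩
  · rintro ⟨q, -, rfl⟩
    exact ⟨q, rfl⟩

lemma cnt_eq_card {m n : ℕ} (e f : ℕ) (hm : m ≤ 3) (hn : n ≤ 3) :
    cnt m n e f = countNew (subReps.map (key m n e f)) 0 := by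
  unfold cnt
  rw [range_key_eq e f hm hn, Nat.card_coe_set_eq, Set.ncard_coe_finset, countNew_zero]

lemma parity_of_window {p q : ℕ × ℕ} (h : window 3 3 0 0 p = window 3 3 0 0 q) :
    key 3 3 0 0 p = key 3 3 0 0 q := by
  have hdiv (p : ℕ × ℕ) : key 3 3 0 0 p / 4 = bitsCode (window 3 3 0 0 p) := by
    simp only [key]
    omega
  have hcard : ((subReps.map (key 3 3 0 0)).toFinset.image (· / 4)).card =
      (subReps.map (key 3 3 0 0)).toFinset.card := by
    rw [show (subReps.map (key 3 3 0 0)).toFinset.image (· / 4) =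
        ((subReps.map (key 3 3 0 0)).map (· / 4)).toFinset from
        Finset.ext fun _ => by simp only [Finset.mem_image, List.mem_toFinset, List.mem_map],
      ← countNew_zero, ← countNew_zero]
    decide +kernel
  have hmem (p : ℕ × ℕ) : key 3 3 0 0 p ∈ (subReps.map (key 3 3 0 0)).toFinset := by
    rw [← Finset.mem_coe, ← range_key_eq 0 0 le_rfl le_rfl]
    exact Set.mem_range_self p
  exact Finset.card_image_iff.1 hcard (hmem p) (hmem q) (by simp only [hdiv, h])

lemma cnt_base :
    cnt 2 2 0 0 = 76 ∧ cnt 2 2 0 1 = 48 ∧ cnt 2 2 1 0 = 40 ∧ cnt 2 2 1 1 = 20 ∧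
    cnt 2 3 0 0 = 128 ∧ cnt 2 3 0 1 = 88 ∧ cnt 2 3 1 0 = 80 ∧ cnt 2 3 1 1 = 48 ∧
    cnt 3 2 0 0 = 116 ∧ cnt 3 2 0 1 = 80 ∧ cnt 3 2 1 0 = 68 ∧ cnt 3 2 1 1 = 40 ∧
    cnt 3 3 0 0 = 184 ∧ cnt 3 3 0 1 = 136 ∧ cnt 3 3 1 0 = 120 ∧ cnt 3 3 1 1 = 80 := by
  simp only [cnt_eq_card, Nat.reduceLeDiff, le_refl]
  decide +kernel

lemma Acnt_eq_cnt {n : ℕ} (hn : 3 ≤ n) : Acnt n = cnt n n 0 0 := by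
  unfold Acnt cnt
  rw [PS_eq_range]
  refine card_range_congr fun p q => ?_
  rw [key_eq_iff]
  constructor
  · intro h
    have hx (x : ℕ) (hx : x < n) (y : ℕ) (hy : y < n) :=
      symb_inj.1 (congrFun (congrFun h ⟨x, hx⟩) ⟨y, hy⟩)
    refine ⟨(key_eq_iff.1 (parity_of_window (window_eq_iff.2 ⟨?_, ?_⟩))).1,
      fun x h y h' _ => (hx x h y h').1, fun x h y h' => (hx x h y h').2⟩
    · exact fun x h y h' _ => (hx x (by omega) y (by omega)).1
    · exact fun x h y h' => (hx x (by omega) y (by omega)).2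
  · rintro ⟨-, hU, hV⟩
    funext i j
    exact symb_inj.2 ⟨hU i i.2 j j.2 (Nat.zero_le _), hV i i.2 j j.2⟩

/-- Linear relations between the window counts of consecutive sizes. -/
def Relations (n : ℕ) : Prop :=
  (cnt (n + 1) (n + 1) 0 1 + cnt (n + 1) (n + 1) 1 0 + cnt (n + 1) (n + 1) 1 1 =
    2 * cnt n n 0 0 + cnt (n + 1) (n + 1) 0 0) ∧
  (cnt (n + 1) (n + 1) 0 1 + cnt (n + 1) (n + 1) 1 0 + 5 * cnt (n + 1) (n + 1) 1 1 =
    2 * cnt n n 0 0 + 2 * cnt n (n + 1) 1 0 + 2 * cnt (n + 1) n 0 1 +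
      cnt (n + 1) (n + 1) 0 0) ∧
  (2 * cnt n (n + 1) 1 1 + 2 * cnt (n + 1) n 1 1 + 2 * cnt (n + 1) (n + 1) 1 1 =
    3 * cnt n n 0 0 + cnt n n 0 1 + cnt n n 1 0 + cnt n n 1 1) ∧
  (4 * cnt n (n + 1) 1 1 + 4 * cnt (n + 1) n 1 1 + 6 * cnt (n + 1) (n + 1) 1 1 =
    3 * cnt n n 0 0 + 3 * cnt n n 0 1 + 3 * cnt n n 1 0 + cnt n n 1 1 +
      2 * cnt n (n + 1) 1 0 + 2 * cnt (n + 1) n 0 1)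

lemma Relations.even {k : ℕ} (hk : 2 ≤ k) (h : Relations k) : Relations (2 * k) := by
  have hk' : 1 ≤ k := by omega
  obtain ⟨h1, h2, h3, h4⟩ := h
  simp only [Relations, cnt_even_even, cnt_even_odd, cnt_odd_even, cnt_odd_odd, hk, hk',
    zero_le, le_refl]
  omega

lemma Relations.odd {k : ℕ} (hk : 1 ≤ k) (h : Relations (k + 1)) : Relations (2 * k + 1) := by
  have hk' : 2 ≤ k + 1 := by omega
  obtain ⟨h1, h2, h3, h4⟩ := h
  simp only [Relations, show 2 * k + 1 + 1 = 2 * (k + 1) by ring, cnt_even_even, cnt_even_odd,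
    cnt_odd_even, cnt_odd_odd, hk, hk', zero_le, le_refl]
  omega

lemma relations {n : ℕ} (hn : 2 ≤ n) : Relations n := by
  induction n using Nat.strong_induction_on with
  | _ n ih =>
    rcases hn.eq_or_lt with rfl | hn
    · have := cnt_base
      simp only [Relations, Nat.reduceAdd]
      omega
    · rcases Nat.even_or_odd' n with ⟨k, rfl | rfl⟩
      · exact (ih k (by omega) (by omega)).even (by omega)
      · exact (ih (k + 1) (by omega) (by omega)).odd (by omega)

end Paperfold

/-- Lemma 5.4: for n ≥ 3, A_{2n+1} = 2·A_n + 2·A_{n+1}. -/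
theorem A_odd_recursion (n : ℕ) (hn : 3 ≤ n) :
    Acnt (2 * n + 1) = 2 * Acnt n + 2 * Acnt (n + 1) := by
  rw [Paperfold.Acnt_eq_cnt hn, Paperfold.Acnt_eq_cnt (by omega : 3 ≤ n + 1),
    Paperfold.Acnt_eq_cnt (by omega : 3 ≤ 2 * n + 1),
    Paperfold.cnt_odd_odd (by omega) (by omega) zero_le_one zero_le_one]
  have := (Paperfold.relations (by omega : 2 ≤ n)).1
  omega
end
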